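/- (Quantitative flat extrapolation, upward case) Let 1 < p₀ < p < ∞, let p' = p/(p−1), let 0 < ε < 1, let δ₀ > 0 and let F : [1,∞) → (0,∞) be an increasing function. Let T be an operator mapping measurable functions on ℝⁿ to nonnegative measurable functions such that ‖Tf‖_{L^{p₀}(v)} ≤ F([v]_{A_{p₀}})‖f‖_{L^{p₀}(v)} for every weight v ∈ A_{p₀} with [v]_{A_{p₀}} ≤ 1 + δ₀ and every f ∈ L^{p₀}(v). Let w ∈ A_p be a weight satisfying (1+ε)^{(p−p₀)/(p−1)}·‖M‖_{L^{p'}(w^{1−p'})→L^{p'}(w^{1−p'})}^{(p−p₀)/(p−1)}·[w]_{A_p}^{(p₀−1)/(p−1)} ≤ 1 + δ₀. Then for every nonnegative f ∈ L^p(w), ‖Tf‖_{L^p(w)} ≤ ((1+ε)/ε)^{(p−p₀)/(p₀(p−1))} · F((1+ε)^{(p−p₀)/(p−1)}·‖M‖_{L^{p'}(w^{1−p'})→L^{p'}(w^{1−p'})}^{(p−p₀)/(p−1)}·[w]_{A_p}^{(p₀−1)/(p−1)}) · ‖f‖_{L^p(w)}. -/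

import Mathlib

open MeasureTheory Set Filter ENNReal

noncomputable section

/-- An axis-parallel cube in `ℝⁿ` with positive side length. -/
def IsCube {n : ℕ} (Q : Set (Fin n → ℝ)) : Prop :=
  ∃ (a : Fin n → ℝ) (r : ℝ), 0 < r ∧ Q = Set.Icc a (fun i => a i + r)

/-- The average `|Q|⁻¹ ∫_Q f dx` (of the nonnegative part of `f`), as a value in `ℝ≥0∞`. -/
def avg {n : ℕ} (Q : Set (Fin n → ℝ)) (f : (Fin n → ℝ) → ℝ) : ℝ≥0∞ :=
  (∫⁻ x in Q, ENNReal.ofReal (f x)) / volume Q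

/-- A weight on `ℝⁿ`: a positive (almost everywhere) locally integrable function. -/
def IsWeight {n : ℕ} (w : (Fin n → ℝ) → ℝ) : Prop :=
  (∀ᵐ x ∂(volume : Measure (Fin n → ℝ)), 0 < w x) ∧ LocallyIntegrable w volume

/-- The `A_p` characteristic `sup_Q (|Q|⁻¹∫_Q w)(|Q|⁻¹∫_Q w^{-1/(p-1)})^{p-1}`,
as a value in `ℝ≥0∞`. -/
def apCharE {n : ℕ} (p : ℝ) (w : (Fin n → ℝ) → ℝ) : ℝ≥0∞ :=
  ⨆ (Q : Set (Fin n → ℝ)) (_ : IsCube Q),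
    avg Q w * (avg Q (fun x => w x ^ (-(1 / (p - 1))))) ^ (p - 1)

/-- The `A_p` characteristic of `w`, as a real number. -/
def apChar {n : ℕ} (p : ℝ) (w : (Fin n → ℝ) → ℝ) : ℝ :=
  (apCharE p w).toReal

/-- Membership in the Muckenhoupt class `A_p`: `w` is a weight with finite `A_p`
characteristic. -/
def MemAp {n : ℕ} (p : ℝ) (w : (Fin n → ℝ) → ℝ) : Prop :=
  IsWeight w ∧ apCharE p w ≠ ⊤

/-- The non-centered Hardy–Littlewood maximal function (`ℝ≥0∞`-valued):
`Mf(x) = sup_{Q ∋ x} |Q|⁻¹ ∫_Q |f|`. -/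
def maximalE {n : ℕ} (f : (Fin n → ℝ) → ℝ) (x : Fin n → ℝ) : ℝ≥0∞ :=
  ⨆ (Q : Set (Fin n → ℝ)) (_ : IsCube Q) (_ : x ∈ Q), avg Q (fun y => |f y|)

/-- The non-centered Hardy–Littlewood maximal function, real-valued. -/
def maximal {n : ℕ} (f : (Fin n → ℝ) → ℝ) (x : Fin n → ℝ) : ℝ :=
  (maximalE f x).toReal

/-- The norm `(∫ |f|^p w dx)^{1/p}` of `f` in `L^p(w)`, as a value in `ℝ≥0∞`. -/
def eLpNormW {n : ℕ} (p : ℝ) (w f : (Fin n → ℝ) → ℝ) : ℝ≥0∞ :=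
  (∫⁻ x, ENNReal.ofReal (|f x| ^ p) * ENNReal.ofReal (w x)) ^ (1 / p)

/-- Membership in `L^p(w)`: `f` is measurable with finite `L^p(w)` norm. -/
def MemLpW {n : ℕ} (p : ℝ) (w f : (Fin n → ℝ) → ℝ) : Prop :=
  Measurable f ∧ eLpNormW p w f ≠ ⊤

/-- `T` is (strongly) bounded on `L^p(w)` with constant `c`:
`‖Tf‖_{L^p(w)} ≤ c ‖f‖_{L^p(w)}` for all `f ∈ L^p(w)`. -/
def StrongBound {n : ℕ} (p : ℝ) (w : (Fin n → ℝ) → ℝ)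
    (T : ((Fin n → ℝ) → ℝ) → (Fin n → ℝ) → ℝ) (c : ℝ) : Prop :=
  ∀ f, MemLpW p w f → eLpNormW p w (T f) ≤ ENNReal.ofReal c * eLpNormW p w f

/-- The operator norm of `T` on `L^p(w)`: the least constant in a strong bound. -/
def opNorm {n : ℕ} (p : ℝ) (w : (Fin n → ℝ) → ℝ)
    (T : ((Fin n → ℝ) → ℝ) → (Fin n → ℝ) → ℝ) : ℝ :=
  sInf { c : ℝ | 0 ≤ c ∧ StrongBound p w T c }

/-- The `w`-measure `w(E) = ∫_E w dx` of a set `E`. -/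
def wMeasure {n : ℕ} (w : (Fin n → ℝ) → ℝ) (E : Set (Fin n → ℝ)) : ℝ≥0∞ :=
  ∫⁻ x in E, ENNReal.ofReal (w x)

/-- `T` is of weak type `(p,p)` with respect to `w`, with constant `c`:
`λ · w({|Tf| > λ})^{1/p} ≤ c ‖f‖_{L^p(w)}` for all `λ > 0` and `f ∈ L^p(w)`. -/
def WeakBound {n : ℕ} (p : ℝ) (w : (Fin n → ℝ) → ℝ)
    (T : ((Fin n → ℝ) → ℝ) → (Fin n → ℝ) → ℝ) (c : ℝ) : Prop :=
  ∀ f, MemLpW p w f → ∀ lam : ℝ, 0 < lam →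
    ENNReal.ofReal lam * wMeasure w {x | lam < |T f x|} ^ (1 / p)
      ≤ ENNReal.ofReal c * eLpNormW p w f

/-- The weak-type `(p,p)` norm `‖T‖_{L^p(w) → L^{p,∞}(w)}`: the least constant in a
weak bound. -/
def weakNorm {n : ℕ} (p : ℝ) (w : (Fin n → ℝ) → ℝ)
    (T : ((Fin n → ℝ) → ℝ) → (Fin n → ℝ) → ℝ) : ℝ :=
  sInf { c : ℝ | 0 ≤ c ∧ WeakBound p w T c }

/-- Membership in `A₁`: `u` is a weight with `Mu ≤ c·u` a.e. for some `c`. -/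
def MemA1 {n : ℕ} (u : (Fin n → ℝ) → ℝ) : Prop :=
  IsWeight u ∧ ∃ c : ℝ, ∀ᵐ x ∂(volume : Measure (Fin n → ℝ)),
    maximalE u x ≤ ENNReal.ofReal (c * u x)

/-- The `A₁` characteristic of `u`: the least `c` with `Mu ≤ c·u` a.e. -/
def a1Char {n : ℕ} (u : (Fin n → ℝ) → ℝ) : ℝ :=
  sInf { c : ℝ | ∀ᵐ x ∂(volume : Measure (Fin n → ℝ)),
    maximalE u x ≤ ENNReal.ofReal (c * u x) }

/-- The dual maximal operator `M'f = M(fw)/w`. -/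
def dualMax {n : ℕ} (w : (Fin n → ℝ) → ℝ) (f : (Fin n → ℝ) → ℝ)
    (x : Fin n → ℝ) : ℝ :=
  maximal (fun y => f y * w y) x / w x

/-- Weighted maximal operator with respect to a measure. -/
def MQ {n : ℕ} (μ : Measure (Fin n → ℝ)) (g : (Fin n → ℝ) → ℝ≥0∞) (x : Fin n → ℝ) : ℝ≥0∞ :=
  ⨆ (Q : Set (Fin n → ℝ)) (_ : IsCube Q) (_ : x ∈ Q), (∫⁻ y in Q, g y ∂μ) / μ Q

lemma closedBall_eq_cube {n : ℕ} (c : Fin n → ℝ) (r : ℝ) (hr : 0 < r) :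
    Metric.closedBall c r = Set.Icc (fun i => c i - r) (fun i => (c i - r) + 2 * r) := by
  rw [closedBall_pi _ hr.le, ← pi_univ_Icc]
  congr 1; ext i y
  rw [Real.closedBall_eq_Icc]
  simp only [Set.mem_Icc]
  constructor <;> rintro ⟨h1, h2⟩ <;> constructor <;> linarith

lemma isCube_closedBall {n : ℕ} (c : Fin n → ℝ) (r : ℝ) (hr : 0 < r) :
    IsCube (Metric.closedBall c r) :=
  ⟨fun i => c i - r, 2 * r, by positivity, closedBall_eq_cube c r hr⟩

lemma IsCube.exists_ball {n : ℕ} {Q : Set (Fin n → ℝ)} (h : IsCube Q) :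
    ∃ (c : Fin n → ℝ) (r : ℝ), 0 < r ∧ Q = Metric.closedBall c r := by
  obtain ⟨a, r, hr, rfl⟩ := h
  refine ⟨fun i => a i + r / 2, r / 2, by positivity, ?_⟩
  rw [closedBall_eq_cube _ _ (by positivity)]
  congr 1 <;> ext i <;> ring

lemma IsCube.measurableSet {n : ℕ} {Q : Set (Fin n → ℝ)} (h : IsCube Q) : MeasurableSet Q := by
  obtain ⟨c, r, hr, rfl⟩ := h.exists_ball
  exact measurableSet_closedBall

lemma IsCube.measure_ne_zero {n : ℕ} {Q : Set (Fin n → ℝ)} (h : IsCube Q)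
    (μ : Measure (Fin n → ℝ)) [μ.IsOpenPosMeasure] : μ Q ≠ 0 := by
  obtain ⟨c, r, hr, rfl⟩ := h.exists_ball
  exact (Metric.measure_closedBall_pos μ c hr).ne'

lemma IsCube.measure_ne_top {n : ℕ} {Q : Set (Fin n → ℝ)} (h : IsCube Q)
    (μ : Measure (Fin n → ℝ)) [IsLocallyFiniteMeasure μ] : μ Q ≠ ⊤ := by
  obtain ⟨c, r, hr, rfl⟩ := h.exists_ball
  exact (isCompact_closedBall c r).measure_lt_top.ne

lemma lt_MQ_iff {n : ℕ} (μ : Measure (Fin n → ℝ)) (g : (Fin n → ℝ) → ℝ≥0∞) (x : Fin n → ℝ)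
    (t : ℝ≥0∞) : t < MQ μ g x ↔ ∃ (c : Fin n → ℝ) (r : ℝ), 0 < r ∧ x ∈ Metric.closedBall c r ∧
      t < (∫⁻ y in Metric.closedBall c r, g y ∂μ) / μ (Metric.closedBall c r) := by
  unfold MQ
  simp only [lt_iSup_iff]
  constructor
  · rintro ⟨Q, hQ, hx, h⟩
    obtain ⟨c, r, hr, rfl⟩ := hQ.exists_ball
    exact ⟨c, r, hr, hx, h⟩
  · rintro ⟨c, r, hr, hx, h⟩
    exact ⟨_, isCube_closedBall c r hr, hx, h⟩

lemma le_MQ {n : ℕ} (μ : Measure (Fin n → ℝ)) (g : (Fin n → ℝ) → ℝ≥0∞) {x : Fin n → ℝ}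
    {Q : Set (Fin n → ℝ)} (hQ : IsCube Q) (hx : x ∈ Q) :
    (∫⁻ y in Q, g y ∂μ) / μ Q ≤ MQ μ g x :=
  le_iSup_of_le Q (le_iSup_of_le hQ (le_iSup_of_le hx le_rfl))

lemma isOpen_MQ {n : ℕ} (μ : Measure (Fin n → ℝ)) [IsLocallyFiniteMeasure μ]
    [μ.IsOpenPosMeasure] (g : (Fin n → ℝ) → ℝ≥0∞) (t : ℝ≥0∞) :
    IsOpen {x | t < MQ μ g x} := by
  rw [isOpen_iff_mem_nhds]
  intro x hx
  obtain ⟨c, r, hr, hxc, h⟩ := (lt_MQ_iff μ g x t).1 hx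
  have hfin : ∀ s, μ (Metric.closedBall c s) ≠ ⊤ := fun s =>
    (isCompact_closedBall c s).measure_lt_top.ne
  have hpos : μ (Metric.closedBall c r) ≠ 0 := (Metric.measure_closedBall_pos μ c hr).ne'
  rw [ENNReal.lt_div_iff_mul_lt (Or.inl hpos) (Or.inl (hfin _))] at h
  have httop : t ≠ ⊤ := hx.ne_top
  have hlim : Tendsto (fun s => μ (Metric.closedBall c s)) (nhdsWithin r (Ioi r))
      (nhds (μ (Metric.closedBall c r))) := by
    have := tendsto_measure_biInter_gt (μ := μ) (ι := ℝ) (s := fun s => Metric.closedBall c s)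
      (a := r) (fun s _ => measurableSet_closedBall.nullMeasurableSet)
      (fun i j _ hij => Metric.closedBall_subset_closedBall hij) ⟨r + 1, by simp, hfin _⟩
    have heq : (⋂ s > r, Metric.closedBall c s) = Metric.closedBall c r := by
      ext y
      simp only [Metric.mem_closedBall, mem_iInter, gt_iff_lt]
      exact ⟨fun h => le_of_forall_gt_imp_ge_of_dense h, fun h s hs => h.trans hs.le⟩
    rwa [heq] at this
  have hlim2 : Tendsto (fun s => t * μ (Metric.closedBall c s)) (nhdsWithin r (Ioi r))
      (nhds (t * μ (Metric.closedBall c r))) :=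
    ENNReal.Tendsto.const_mul hlim (Or.inr httop)
  have hev := (hlim2.eventually_lt_const h).and self_mem_nhdsWithin
  obtain ⟨s, hs, hsr⟩ := hev.exists
  have hsr : r < s := hsr
  have hs0 : 0 < s := hr.trans hsr
  refine Filter.mem_of_superset (Metric.closedBall_mem_nhds_of_mem (x := x) (c := c) (ε := s) ?_) ?_
  · exact lt_of_le_of_lt hxc hsr
  · intro y hy
    refine (lt_MQ_iff μ g y t).2 ⟨c, s, hs0, hy, ?_⟩
    rw [ENNReal.lt_div_iff_mul_lt (Or.inl (Metric.measure_closedBall_pos μ c hs0).ne')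
      (Or.inl (hfin _))]
    exact hs.trans_le (lintegral_mono_set (Metric.closedBall_subset_closedBall hsr.le))

lemma measurable_MQ {n : ℕ} (μ : Measure (Fin n → ℝ)) [IsLocallyFiniteMeasure μ]
    [μ.IsOpenPosMeasure] (g : (Fin n → ℝ) → ℝ≥0∞) : Measurable (MQ μ g) :=
  measurable_of_Ioi fun t => (isOpen_MQ μ g t).measurableSet

/-- Weak type (1,1). -/
lemma weak_MQ {n : ℕ} (μ : Measure (Fin n → ℝ)) [IsLocallyFiniteMeasure μ]
    [μ.IsOpenPosMeasure] (D : ℝ≥0∞)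
    (hD : ∀ (c : Fin n → ℝ) (r : ℝ), 0 < r →
      μ (Metric.closedBall c (5 * r)) ≤ D * μ (Metric.closedBall c r))
    (g : (Fin n → ℝ) → ℝ≥0∞) (t : ℝ≥0∞) :
    t * μ {x | t < MQ μ g x} ≤ D * ∫⁻ x, g x ∂μ := by
  classical
  let S : Set ((Fin n → ℝ) × ℝ) := {a | 0 < a.2 ∧
    t < (∫⁻ y in Metric.closedBall a.1 a.2, g y ∂μ) / μ (Metric.closedBall a.1 a.2)}
  let E : ℕ → Set (Fin n → ℝ) := fun N => ⋃ a ∈ {a ∈ S | a.2 ≤ N}, Metric.closedBall a.1 a.2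
  have hE : {x | t < MQ μ g x} = ⋃ N, E N := by
    ext x
    simp only [mem_ofPred_eq, lt_MQ_iff, mem_iUnion, E, S]
    constructor
    · rintro ⟨c, r, hr, hx, h⟩
      obtain ⟨N, hN⟩ := exists_nat_ge r
      exact ⟨N, (c, r), ⟨⟨hr, h⟩, hN⟩, hx⟩
    · rintro ⟨N, a, ⟨⟨hr, h⟩, hN⟩, hx⟩
      exact ⟨a.1, a.2, hr, hx, h⟩
  have hmono : Monotone E := by
    intro N M hNM
    refine biUnion_subset_biUnion_left ?_
    rintro a ⟨h1, h2⟩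
    exact ⟨h1, h2.trans (by exact_mod_cast hNM)⟩
  rw [hE, hmono.measure_iUnion, ENNReal.mul_iSup]
  refine iSup_le fun N => ?_
  obtain ⟨u, hut, hdisj, hcov⟩ := Vitali.exists_disjoint_subfamily_covering_enlargement_closedBall
    {a ∈ S | a.2 ≤ N} (fun a => a.1) (fun a => a.2) N (fun a ha => ha.2) 5 (by norm_num)
  have hcount : u.Countable := by
    refine hdisj.countable_of_nonempty_interior fun a ha => ?_
    exact ⟨a.1, Metric.ball_subset_interior_closedBall (Metric.mem_ball_self (hut ha).1.1)⟩
  have hsub : E N ⊆ ⋃ a ∈ u, Metric.closedBall a.1 (5 * a.2) := by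
    refine iUnion₂_subset fun a ha => ?_
    obtain ⟨b, hb, hab⟩ := hcov a ha
    exact hab.trans (subset_biUnion_of_mem (u := fun a : (Fin n → ℝ) × ℝ =>
      Metric.closedBall a.1 (5 * a.2)) hb)
  calc t * μ (E N) ≤ t * ∑' a : u, μ (Metric.closedBall a.1.1 (5 * a.1.2)) := by
        gcongr
        exact (measure_mono hsub).trans (measure_biUnion_le μ hcount _)
    _ ≤ t * ∑' a : u, D * μ (Metric.closedBall a.1.1 a.1.2) := by
        gcongr with a
        exact hD _ _ (hut a.2).1.1
    _ = D * ∑' a : u, t * μ (Metric.closedBall a.1.1 a.1.2) := by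
        rw [ENNReal.tsum_mul_left, ENNReal.tsum_mul_left]; ring
    _ ≤ D * ∑' a : u, ∫⁻ y in Metric.closedBall a.1.1 a.1.2, g y ∂μ := by
        gcongr with a
        exact ENNReal.mul_le_of_le_div (hut a.2).1.2.le
    _ = D * ∫⁻ y in ⋃ a ∈ u, Metric.closedBall a.1 a.2, g y ∂μ := by
        rw [lintegral_biUnion hcount (fun _ _ => measurableSet_closedBall) hdisj]
    _ ≤ D * ∫⁻ x, g x ∂μ := by
        gcongr
        exact Measure.restrict_le_self

lemma MQ_split {n : ℕ} (μ : Measure (Fin n → ℝ)) [IsLocallyFiniteMeasure μ]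
    [μ.IsOpenPosMeasure] (g : (Fin n → ℝ) → ℝ≥0∞) (t : ℝ≥0∞) (x : Fin n → ℝ) :
    MQ μ g x ≤ MQ μ ({y | t < g y}.indicator g) x + t := by
  refine iSup_le fun Q => iSup_le fun hQ => iSup_le fun hx => ?_
  have h0 := hQ.measure_ne_zero μ
  have h1 := hQ.measure_ne_top μ
  calc (∫⁻ y in Q, g y ∂μ) / μ Q
      ≤ (∫⁻ y in Q, ({y | t < g y}.indicator g y + t) ∂μ) / μ Q := by
        gcongr with y
        by_cases h : t < g y
        · rw [indicator_of_mem (by exact h)]; exact le_self_add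
        · rw [indicator_of_notMem (by exact h), zero_add]; exact not_lt.1 h
    _ = (∫⁻ y in Q, {y | t < g y}.indicator g y ∂μ) / μ Q + t := by
        rw [lintegral_add_right _ measurable_const, ENNReal.add_div]
        simp only [lintegral_const, Measure.restrict_apply, MeasurableSet.univ, univ_inter]
        rw [ENNReal.mul_div_cancel_right h0 h1]
    _ ≤ _ := by gcongr; exact le_MQ μ _ hQ hx

lemma lintegral_layer (s : ℝ) (hs : 0 < s) (a : ℝ≥0∞) :
    ∫⁻ t in Ioi (0 : ℝ), {t : ℝ | ENNReal.ofReal t < a}.indicator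
      (fun t => ENNReal.ofReal (t ^ (s - 1))) t = a ^ s / ENNReal.ofReal s := by
  have key : ∀ b : ℝ, 0 ≤ b → ∫⁻ t in Ioo (0 : ℝ) b, ENNReal.ofReal (t ^ (s - 1))
      = ENNReal.ofReal b ^ s / ENNReal.ofReal s := by
    intro b hb
    have hintv : IntervalIntegrable (fun t : ℝ => t ^ (s - 1)) volume 0 b :=
      intervalIntegral.intervalIntegrable_rpow' (by linarith)
    rw [restrict_Ioo_eq_restrict_Ioc, ← ofReal_integral_eq_lintegral_ofReal,
      ← intervalIntegral.integral_of_le hb, integral_rpow (Or.inl (by linarith))]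
    · rw [sub_add_cancel, Real.zero_rpow hs.ne', sub_zero, ENNReal.ofReal_div_of_pos hs,
        ENNReal.ofReal_rpow_of_nonneg hb hs.le]
    · exact (intervalIntegrable_iff_integrableOn_Ioc_of_le hb).1 hintv
    · refine (ae_restrict_iff' measurableSet_Ioc).2 (Eventually.of_forall fun t ht => ?_)
      exact Real.rpow_nonneg ht.1.le _
  have hms : MeasurableSet {t : ℝ | ENNReal.ofReal t < a} :=
    measurableSet_lt ENNReal.measurable_ofReal measurable_const
  rw [lintegral_indicator hms, Measure.restrict_restrict hms]
  by_cases ha : a = ⊤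
  · subst ha
    have : {t : ℝ | ENNReal.ofReal t < ⊤} = univ := by ext; simp
    rw [this, univ_inter, ENNReal.top_rpow_of_pos hs, ENNReal.top_div_of_ne_top ofReal_ne_top]
    have h : ∀ N : ℕ, (N : ℝ≥0∞) ^ s / ENNReal.ofReal s ≤
        ∫⁻ t in Ioi (0 : ℝ), ENNReal.ofReal (t ^ (s - 1)) := by
      intro N
      have := key N (by positivity)
      rw [ENNReal.ofReal_natCast] at this
      rw [← this]
      exact lintegral_mono_set Ioo_subset_Ioi_self
    have hl : Tendsto (fun N : ℕ => (N : ℝ≥0∞) ^ s / ENNReal.ofReal s) atTop (nhds ⊤) := by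
      have h1 : Tendsto (fun N : ℕ => (N : ℝ≥0∞) ^ s) atTop (nhds (⊤ ^ s)) :=
        (ENNReal.continuous_rpow_const.tendsto _).comp ENNReal.tendsto_nat_nhds_top
      have := ENNReal.Tendsto.div_const h1 (b := ENNReal.ofReal s) (Or.inr (by simpa using hs))
      rwa [ENNReal.top_rpow_of_pos hs, ENNReal.top_div_of_ne_top ofReal_ne_top] at this
    exact top_unique (le_of_tendsto' hl h)
  · have : {t : ℝ | ENNReal.ofReal t < a} ∩ Ioi 0 = Ioo 0 a.toReal := by
      ext t
      simp only [mem_inter_iff, mem_ofPred_eq, mem_Ioi, mem_Ioo]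
      constructor
      · rintro ⟨h1, h2⟩
        exact ⟨h2, (ENNReal.ofReal_lt_iff_lt_toReal h2.le ha).1 h1⟩
      · rintro ⟨h1, h2⟩
        exact ⟨(ENNReal.ofReal_lt_iff_lt_toReal h1.le ha).2 h2, h1⟩
    rw [this, key _ toReal_nonneg, ENNReal.ofReal_toReal ha]


lemma rpow_eq_layer (s : ℝ) (hs : 0 < s) (a : ℝ≥0∞) :
    a ^ s = ENNReal.ofReal s * ∫⁻ t in Ioi (0 : ℝ), {t : ℝ | ENNReal.ofReal t < a}.indicator
      (fun t => ENNReal.ofReal (t ^ (s - 1))) t := by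
  rw [lintegral_layer s hs, ENNReal.mul_div_cancel (by simpa using hs) ofReal_ne_top]

lemma meas_layer {n : ℕ} (s : ℝ) (G : (Fin n → ℝ) → ℝ≥0∞) (hG : Measurable G) :
    Measurable (fun z : (Fin n → ℝ) × ℝ => {t : ℝ | ENNReal.ofReal t < G z.1}.indicator
      (fun t => ENNReal.ofReal (t ^ s)) z.2) := by
  have : (fun z : (Fin n → ℝ) × ℝ => {t : ℝ | ENNReal.ofReal t < G z.1}.indicator
      (fun t => ENNReal.ofReal (t ^ s)) z.2) =
      {z : (Fin n → ℝ) × ℝ | ENNReal.ofReal z.2 < G z.1}.indicator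
        (fun z => ENNReal.ofReal (z.2 ^ s)) := by
    ext z; simp only [indicator, mem_ofPred_eq]
  rw [this]
  refine Measurable.indicator (by fun_prop) ?_
  exact measurableSet_lt (by fun_prop) (by fun_prop)

lemma strong_MQ {n : ℕ} (μ : Measure (Fin n → ℝ)) [IsLocallyFiniteMeasure μ]
    [μ.IsOpenPosMeasure] (D : ℝ≥0∞) (hDt : D ≠ ⊤)
    (hD : ∀ (c : Fin n → ℝ) (r : ℝ), 0 < r →
      μ (Metric.closedBall c (5 * r)) ≤ D * μ (Metric.closedBall c r)) (q : ℝ) (hq : 1 < q) :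
    ∃ C : ℝ≥0∞, C ≠ ⊤ ∧ ∀ g : (Fin n → ℝ) → ℝ≥0∞, Measurable g →
      ∫⁻ x, MQ μ g x ^ q ∂μ ≤ C * ∫⁻ x, g x ^ q ∂μ := by
  have hq0 : 0 < q := by linarith
  have hq1 : 0 < q - 1 := by linarith
  refine ⟨ENNReal.ofReal q * (2 * D * (2 ^ (q - 1) / ENNReal.ofReal (q - 1))), ?_, ?_⟩
  · have h2 : (2 : ℝ≥0∞) ^ (q - 1) ≠ ⊤ := ENNReal.rpow_ne_top_of_nonneg hq1.le (by simp)
    have h3 : ENNReal.ofReal (q - 1) ≠ 0 := by simpa using hq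
    exact ENNReal.mul_ne_top ofReal_ne_top (ENNReal.mul_ne_top (ENNReal.mul_ne_top (by simp) hDt)
      (ENNReal.div_ne_top h2 h3))
  intro g hg
  have hM := measurable_MQ μ g
  have hpt : ∀ t : ℝ, 0 < t → ENNReal.ofReal (t ^ (q - 1)) * μ {x | ENNReal.ofReal t < MQ μ g x} ≤
      2 * D * ∫⁻ x, g x * {t : ℝ | ENNReal.ofReal t < 2 * g x}.indicator
        (fun t => ENNReal.ofReal (t ^ (q - 1 - 1))) t ∂μ := by
    intro t ht
    set τ := ENNReal.ofReal (t / 2) with hτ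
    have ht2 : ENNReal.ofReal t = τ + τ := by
      rw [hτ, ← ENNReal.ofReal_add (by positivity) (by positivity)]; congr 1; ring
    have hτt : τ ≠ ⊤ := ofReal_ne_top
    have hsub : {x | ENNReal.ofReal t < MQ μ g x} ⊆
        {x | τ < MQ μ ({y | τ < g y}.indicator g) x} := by
      intro x hx
      have h1 : ENNReal.ofReal t < MQ μ g x := hx
      have h2 := h1.trans_le (MQ_split μ g τ x)
      rw [ht2] at h2
      exact (ENNReal.add_lt_add_iff_right hτt).1 h2
    have hw := weak_MQ μ D hD ({y | τ < g y}.indicator g) τ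
    have e1 : ENNReal.ofReal (t ^ (q - 1)) = 2 * ENNReal.ofReal (t ^ (q - 1 - 1)) * τ := by
      rw [hτ, show (2 : ℝ≥0∞) = ENNReal.ofReal 2 by simp, ← ENNReal.ofReal_mul (by norm_num),
        ← ENNReal.ofReal_mul (by positivity), Real.rpow_sub_one ht.ne' (q - 1)]
      congr 1; field_simp
    have hind : ∀ x, g x * {t : ℝ | ENNReal.ofReal t < 2 * g x}.indicator
        (fun t => ENNReal.ofReal (t ^ (q - 1 - 1))) t =
        ENNReal.ofReal (t ^ (q - 1 - 1)) * {y | τ < g y}.indicator g x := by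
      intro x
      have : ENNReal.ofReal t < 2 * g x ↔ τ < g x := by
        rw [ht2, ← two_mul]
        exact ENNReal.mul_lt_mul_iff_right (by simp) (by simp)
      simp only [indicator, mem_ofPred_eq, this]
      split_ifs <;> ring
    simp_rw [hind]
    rw [lintegral_const_mul' _ _ ofReal_ne_top, e1]
    calc 2 * ENNReal.ofReal (t ^ (q - 1 - 1)) * τ * μ {x | ENNReal.ofReal t < MQ μ g x}
        ≤ 2 * ENNReal.ofReal (t ^ (q - 1 - 1)) *
          (τ * μ {x | τ < MQ μ ({y | τ < g y}.indicator g) x}) := by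
          rw [mul_assoc]; gcongr
      _ ≤ 2 * ENNReal.ofReal (t ^ (q - 1 - 1)) *
          (D * ∫⁻ x, {y | τ < g y}.indicator g x ∂μ) := by gcongr
      _ = _ := by ring
  calc ∫⁻ x, MQ μ g x ^ q ∂μ
      = ∫⁻ x, ENNReal.ofReal q * (∫⁻ t in Ioi (0 : ℝ),
          {t : ℝ | ENNReal.ofReal t < MQ μ g x}.indicator
            (fun t => ENNReal.ofReal (t ^ (q - 1))) t) ∂μ := by
        refine lintegral_congr fun x => rpow_eq_layer q hq0 _
    _ = ENNReal.ofReal q * ∫⁻ t in Ioi (0 : ℝ), ∫⁻ x,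
          {t : ℝ | ENNReal.ofReal t < MQ μ g x}.indicator
            (fun t => ENNReal.ofReal (t ^ (q - 1))) t ∂μ := by
        rw [lintegral_const_mul' _ _ ofReal_ne_top, lintegral_lintegral_swap]
        exact (meas_layer _ _ hM).aemeasurable
    _ ≤ ENNReal.ofReal q * ∫⁻ t in Ioi (0 : ℝ), 2 * D * ∫⁻ x, g x *
          {t : ℝ | ENNReal.ofReal t < 2 * g x}.indicator
        (fun t => ENNReal.ofReal (t ^ (q - 1 - 1))) t ∂μ := by
        refine mul_le_mul' le_rfl ?_
        refine setLIntegral_mono' measurableSet_Ioi fun t ht => ?_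
        refine le_trans (le_of_eq ?_) (hpt t ht)
        rw [← lintegral_indicator_const (measurableSet_lt measurable_const hM)]
        refine lintegral_congr fun x => ?_
        simp only [indicator, mem_ofPred_eq]
    _ = ENNReal.ofReal q * (2 * D * ∫⁻ x, (∫⁻ t in Ioi (0 : ℝ), g x *
          {t : ℝ | ENNReal.ofReal t < 2 * g x}.indicator
        (fun t => ENNReal.ofReal (t ^ (q - 1 - 1))) t) ∂μ) := by
        rw [lintegral_const_mul' _ _ (ENNReal.mul_ne_top (by simp) hDt), lintegral_lintegral_swap]
        have h1 := meas_layer (q - 1 - 1) (fun x => 2 * g x) (by fun_prop)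
        exact (((hg.comp measurable_fst).mul h1).comp measurable_swap).aemeasurable
    _ = ENNReal.ofReal q * (2 * D * ∫⁻ x, (2 ^ (q - 1) / ENNReal.ofReal (q - 1)) * g x ^ q ∂μ) := by
        congr 2
        refine lintegral_congr fun x => ?_
        rw [lintegral_const_mul, lintegral_layer (q - 1) hq1,
          ENNReal.mul_rpow_of_nonneg _ _ hq1.le]
        · have : g x ^ q = g x * g x ^ (q - 1) := by
            nth_rewrite 2 [← ENNReal.rpow_one (g x)]
            rw [← ENNReal.rpow_add_of_nonneg _ _ zero_le_one hq1.le]; congr 1; ring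
          rw [this, ENNReal.div_eq_inv_mul, ENNReal.div_eq_inv_mul]; ring
        · refine Measurable.indicator (by fun_prop) ?_
          exact measurableSet_lt (by fun_prop) (by fun_prop)
    _ = _ := by
        rw [lintegral_const_mul _ (by fun_prop)]; ring


lemma locFin_wd {n : ℕ} (W : (Fin n → ℝ) → ℝ≥0∞)
    (hfin : ∀ Q : Set (Fin n → ℝ), IsCube Q → ∫⁻ x in Q, W x ≠ ⊤) :
    IsLocallyFiniteMeasure ((volume : Measure (Fin n → ℝ)).withDensity W) := by
  refine ⟨fun x => ⟨Metric.closedBall x 1, Metric.closedBall_mem_nhds x one_pos, ?_⟩⟩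
  rw [withDensity_apply _ measurableSet_closedBall]
  exact (hfin _ (isCube_closedBall x 1 one_pos)).lt_top

lemma openPos_wd {n : ℕ} (W : (Fin n → ℝ) → ℝ≥0∞) (hWm : Measurable W) (hW0 : ∀ x, W x ≠ 0) :
    ((volume : Measure (Fin n → ℝ)).withDensity W).IsOpenPosMeasure :=
  (withDensity_absolutelyContinuous' hWm.aemeasurable
    (Eventually.of_forall hW0)).isOpenPosMeasure

lemma doubling_wd {n : ℕ} (W S : (Fin n → ℝ) → ℝ≥0∞) (hWm : Measurable W) (hSm : Measurable S)
    (hS0 : ∀ x, S x ≠ 0) (a b : ℝ) (ha : 0 < a) (hb : 0 < b) (hab : a + b = 1)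
    (hWS : ∀ x, W x ^ a * S x ^ b = 1) (K : ℝ≥0∞)
    (hSfin : ∀ Q : Set (Fin n → ℝ), IsCube Q → ∫⁻ x in Q, S x ≠ ⊤)
    (hK : ∀ Q : Set (Fin n → ℝ), IsCube Q →
      (∫⁻ x in Q, W x) ^ a * (∫⁻ x in Q, S x) ^ b ≤ K * volume Q)
    (c : Fin n → ℝ) (r : ℝ) (hr : 0 < r) :
    (volume : Measure (Fin n → ℝ)).withDensity W (Metric.closedBall c (5 * r)) ≤
      (K * ENNReal.ofReal (5 ^ n)) ^ (1 / a) *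
        (volume : Measure (Fin n → ℝ)).withDensity W (Metric.closedBall c r) := by
  have h5 : 0 < 5 * r := by positivity
  have hQ := isCube_closedBall c r hr
  have hQ' := isCube_closedBall c (5 * r) h5
  rw [withDensity_apply _ measurableSet_closedBall, withDensity_apply _ measurableSet_closedBall]
  have hsub : Metric.closedBall c r ⊆ Metric.closedBall c (5 * r) :=
    Metric.closedBall_subset_closedBall (by linarith)
  have hvol : volume (Metric.closedBall c (5 * r)) =
      ENNReal.ofReal (5 ^ n) * volume (Metric.closedBall c r) := by
    rw [Real.volume_pi_closedBall _ h5.le, Real.volume_pi_closedBall _ hr.le,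
      ← ENNReal.ofReal_mul (by positivity)]
    congr 1
    simp only [Fintype.card_fin]
    rw [← mul_pow]; congr 1; ring
  set Q := Metric.closedBall c r
  set Q' := Metric.closedBall c (5 * r)
  have h1 : volume Q ≤ (∫⁻ x in Q, W x) ^ a * (∫⁻ x in Q', S x) ^ b := by
    calc volume Q = ∫⁻ x in Q, W x ^ a * S x ^ b := by simp [hWS]
      _ ≤ (∫⁻ x in Q, W x) ^ a * (∫⁻ x in Q, S x) ^ b :=
        ENNReal.lintegral_mul_norm_pow_le hWm.aemeasurable hSm.aemeasurable ha.le hb.le hab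
      _ ≤ _ := by gcongr
  have hSpos : ∫⁻ x in Q', S x ≠ 0 := by
    have := openPos_wd S hSm hS0
    have h := hQ'.measure_ne_zero (volume.withDensity S)
    rwa [withDensity_apply _ hQ'.measurableSet] at h
  have h2 : (∫⁻ x in Q', W x) ^ a ≤ (K * ENNReal.ofReal (5 ^ n)) * (∫⁻ x in Q, W x) ^ a := by
    have h3 : (∫⁻ x in Q', W x) ^ a * (∫⁻ x in Q', S x) ^ b ≤
        ((K * ENNReal.ofReal (5 ^ n)) * (∫⁻ x in Q, W x) ^ a) * (∫⁻ x in Q', S x) ^ b := by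
      refine (hK Q' hQ').trans ?_
      rw [hvol, mul_assoc (K * _), ← mul_assoc K]
      gcongr
    refine (ENNReal.mul_le_mul_iff_left ?_ ?_).1 h3
    · exact (ENNReal.rpow_pos (pos_iff_ne_zero.2 hSpos) (hSfin _ hQ')).ne'
    · exact ENNReal.rpow_ne_top_of_nonneg hb.le (hSfin _ hQ')
  have h4 := ENNReal.rpow_le_rpow h2 (z := 1 / a) (by positivity)
  rw [ENNReal.mul_rpow_of_nonneg _ _ (by positivity), ← ENNReal.rpow_mul, ← ENNReal.rpow_mul,
    mul_one_div_cancel ha.ne', ENNReal.rpow_one, ENNReal.rpow_one] at h4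
  exact h4

/-- Muckenhoupt's theorem, after Lerner. -/
lemma muckenhoupt {n : ℕ} (W S : (Fin n → ℝ) → ℝ≥0∞) (hWm : Measurable W) (hSm : Measurable S)
    (hW0 : ∀ x, W x ≠ 0) (hWt : ∀ x, W x ≠ ⊤)
    (hS0 : ∀ x, S x ≠ 0) (hSt : ∀ x, S x ≠ ⊤) (a b : ℝ) (ha : 0 < a) (hb : 0 < b) (hab : a + b = 1)
    (hWS : ∀ x, W x ^ a * S x ^ b = 1) (K : ℝ≥0∞) (hKt : K ≠ ⊤)
    (hWfin : ∀ Q : Set (Fin n → ℝ), IsCube Q → ∫⁻ x in Q, W x ≠ ⊤)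
    (hSfin : ∀ Q : Set (Fin n → ℝ), IsCube Q → ∫⁻ x in Q, S x ≠ ⊤)
    (hK : ∀ Q : Set (Fin n → ℝ), IsCube Q →
      (∫⁻ x in Q, W x) ^ a * (∫⁻ x in Q, S x) ^ b ≤ K * volume Q) :
    ∃ C : ℝ≥0∞, C ≠ ⊤ ∧ ∀ g : (Fin n → ℝ) → ℝ≥0∞, Measurable g →
      ∫⁻ x, MQ volume g x ^ (1 / b) * S x ≤ C * ∫⁻ x, g x ^ (1 / b) * S x := by
  set μ := (volume : Measure (Fin n → ℝ)).withDensity W with hμ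
  set ν := (volume : Measure (Fin n → ℝ)).withDensity S with hν
  have iμ1 : IsLocallyFiniteMeasure μ := locFin_wd W hWfin
  have iμ2 : μ.IsOpenPosMeasure := openPos_wd W hWm hW0
  have iν1 : IsLocallyFiniteMeasure ν := locFin_wd S hSfin
  have iν2 : ν.IsOpenPosMeasure := openPos_wd S hSm hS0
  have hKn : K * ENNReal.ofReal (5 ^ n) ≠ ⊤ := ENNReal.mul_ne_top hKt ofReal_ne_top
  obtain ⟨C1, hC1, H1⟩ := strong_MQ μ _ (ENNReal.rpow_ne_top_of_nonneg (y := 1 / a) (by positivity)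
    hKn) (doubling_wd W S hWm hSm hS0 a b ha hb hab hWS K hSfin hK) (1 / b)
    (by rw [lt_div_iff₀ hb]; linarith)
  obtain ⟨C2, hC2, H2⟩ := strong_MQ ν _ (ENNReal.rpow_ne_top_of_nonneg (y := 1 / b) (by positivity)
    hKn) (doubling_wd S W hSm hWm hW0 b a hb ha (by linarith)
      (fun x => by rw [mul_comm]; exact hWS x) K hWfin
      (fun Q hQ => by rw [mul_comm]; exact hK Q hQ)) (1 / a)
    (by rw [lt_div_iff₀ ha]; linarith)
  have hWeq : ∀ x, W x = S x ^ (-(b / a)) := by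
    intro x
    have h1 : W x ^ a = S x ^ (-b) := by
      rw [ENNReal.rpow_neg]
      exact ENNReal.eq_inv_of_mul_eq_one_left (hWS x)
    have h2 : (W x ^ a) ^ (1 / a) = (S x ^ (-b)) ^ (1 / a) := by rw [h1]
    rw [← ENNReal.rpow_mul, ← ENNReal.rpow_mul, mul_one_div_cancel ha.ne', ENNReal.rpow_one] at h2
    rw [h2]; congr 1; ring
  have hSeq : ∀ x, S x = W x ^ (-(a / b)) := by
    intro x
    rw [hWeq x, ← ENNReal.rpow_mul]
    have : -(b / a) * -(a / b) = 1 := by field_simp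
    rw [this, ENNReal.rpow_one]
  refine ⟨(K ^ (1 / a)) ^ (1 / b) * (C2 * C1), ?_, ?_⟩
  · exact ENNReal.mul_ne_top (ENNReal.rpow_ne_top_of_nonneg (by positivity)
      (ENNReal.rpow_ne_top_of_nonneg (by positivity) hKt)) (ENNReal.mul_ne_top hC2 hC1)
  intro g hg
  set H : (Fin n → ℝ) → ℝ≥0∞ := MQ μ (fun x => g x / W x) with hH
  have hHm : Measurable H := measurable_MQ μ _
  set G : (Fin n → ℝ) → ℝ≥0∞ := fun x => H x ^ (a / b) / S x with hG
  have hGm : Measurable G := by fun_prop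
  have hpt : ∀ x, MQ volume g x ≤ K ^ (1 / a) * MQ ν G x ^ (b / a) := by
    intro x
    refine iSup_le fun Q => iSup_le fun hQ => iSup_le fun hx => ?_
    have hQm := hQ.measurableSet
    have v0 := hQ.measure_ne_zero (volume : Measure (Fin n → ℝ))
    have vt := hQ.measure_ne_top (volume : Measure (Fin n → ℝ))
    have m0 := hQ.measure_ne_zero μ
    have mt := hQ.measure_ne_top μ
    have n0 := hQ.measure_ne_zero ν
    have nt := hQ.measure_ne_top ν
    have hKQ : μ Q ^ a * ν Q ^ b ≤ K * volume Q := by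
      rw [hμ, hν, withDensity_apply _ hQm, withDensity_apply _ hQm]; exact hK Q hQ
    set m := (∫⁻ y in Q, g y / W y ∂μ) / μ Q with hm
    have e1 : ∫⁻ y in Q, g y = m * μ Q := by
      rw [hm, ENNReal.div_mul_cancel m0 mt, hμ, restrict_withDensity hQm,
        lintegral_withDensity_eq_lintegral_mul _ hWm (by fun_prop)]
      refine lintegral_congr fun y => ?_
      simp only [Pi.mul_apply]
      rw [ENNReal.mul_div_cancel (hW0 y) (hWt y)]
    have e2 : m ^ (a / b) * volume Q ≤ ∫⁻ y in Q, G y ∂ν := by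
      rw [hν, restrict_withDensity hQm,
        lintegral_withDensity_eq_lintegral_mul _ hSm hGm, ← setLIntegral_const]
      refine setLIntegral_mono' hQm fun y hy => ?_
      simp only [Pi.mul_apply, hG]
      rw [ENNReal.mul_div_cancel (hS0 y) (hSt y)]
      gcongr
      exact le_MQ μ _ hQ hy
    have e3 : μ Q / volume Q ≤ K ^ (1 / a) * (volume Q ^ (b / a) / ν Q ^ (b / a)) := by
      have h := ENNReal.rpow_le_rpow hKQ (z := 1 / a) (by positivity)
      rw [ENNReal.mul_rpow_of_nonneg _ _ (by positivity),
        ENNReal.mul_rpow_of_nonneg _ _ (by positivity), ← ENNReal.rpow_mul, ← ENNReal.rpow_mul,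
        mul_one_div_cancel ha.ne', ENNReal.rpow_one, mul_one_div] at h
      have hv : volume Q ^ (1 / a) = volume Q ^ (b / a) * volume Q := by
        nth_rewrite 3 [← ENNReal.rpow_one (volume Q)]
        rw [← ENNReal.rpow_add _ _ v0 vt]; congr 1; field_simp; linarith
      rw [hv] at h
      rw [ENNReal.div_le_iff v0 vt, ← mul_div_assoc, ← ENNReal.mul_div_right_comm,
        ENNReal.le_div_iff_mul_le, mul_assoc]
      · exact h
      · left; exact (ENNReal.rpow_pos (pos_iff_ne_zero.2 n0) nt).ne'
      · left; exact ENNReal.rpow_ne_top_of_nonneg (by positivity) nt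
    calc (∫⁻ y in Q, g y) / volume Q = m * (μ Q / volume Q) := by rw [e1, mul_div_assoc]
      _ ≤ m * (K ^ (1 / a) * (volume Q ^ (b / a) / ν Q ^ (b / a))) := by gcongr
      _ = K ^ (1 / a) * ((m ^ (a / b) * volume Q) / ν Q) ^ (b / a) := by
          rw [ENNReal.div_rpow_of_nonneg _ _ (by positivity),
            ENNReal.mul_rpow_of_nonneg _ _ (by positivity), ← ENNReal.rpow_mul]
          have : a / b * (b / a) = 1 := by field_simp
          rw [this, ENNReal.rpow_one, mul_div_assoc]; ring
      _ ≤ K ^ (1 / a) * ((∫⁻ y in Q, G y ∂ν) / ν Q) ^ (b / a) := by gcongr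
      _ ≤ _ := by gcongr; exact le_MQ ν _ hQ hx
  have hbp : 0 ≤ 1 / b := by positivity
  calc ∫⁻ x, MQ volume g x ^ (1 / b) * S x
      ≤ ∫⁻ x, (K ^ (1 / a)) ^ (1 / b) * (S x * MQ ν G x ^ (1 / a)) := by
        refine lintegral_mono fun x => ?_
        have h := ENNReal.rpow_le_rpow (hpt x) hbp
        rw [ENNReal.mul_rpow_of_nonneg _ _ hbp, ← ENNReal.rpow_mul (MQ ν G x)] at h
        have : b / a * (1 / b) = 1 / a := by field_simp
        rw [this] at h
        calc _ ≤ _ := mul_le_mul' h le_rfl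
          _ = _ := by ring
    _ = (K ^ (1 / a)) ^ (1 / b) * ∫⁻ x, MQ ν G x ^ (1 / a) ∂ν := by
        rw [lintegral_const_mul _ (by have := measurable_MQ ν G; fun_prop), hν,
          lintegral_withDensity_eq_lintegral_mul _ hSm
            (by have := measurable_MQ ν G; fun_prop)]
        rfl
    _ ≤ (K ^ (1 / a)) ^ (1 / b) * (C2 * ∫⁻ x, G x ^ (1 / a) ∂ν) := by
        gcongr; exact H2 G hGm
    _ = (K ^ (1 / a)) ^ (1 / b) * (C2 * ∫⁻ x, H x ^ (1 / b) ∂μ) := by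
        congr 2
        rw [hν, hμ, lintegral_withDensity_eq_lintegral_mul _ hSm (by fun_prop),
          lintegral_withDensity_eq_lintegral_mul _ hWm (by fun_prop)]
        refine lintegral_congr fun x => ?_
        simp only [Pi.mul_apply, hG]
        rw [ENNReal.div_rpow_of_nonneg _ _ (by positivity), ← ENNReal.rpow_mul, hWeq x]
        have h1 : a / b * (1 / a) = 1 / b := by field_simp
        have h2 : S x ^ (-(b / a)) = S x * (S x ^ (1 / a))⁻¹ := by
          rw [← ENNReal.rpow_neg]
          nth_rewrite 2 [← ENNReal.rpow_one (S x)]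
          rw [← ENNReal.rpow_add _ _ (hS0 x) (hSt x)]; congr 1; field_simp; linarith
        rw [h1, h2, div_eq_mul_inv]; ring
    _ ≤ (K ^ (1 / a)) ^ (1 / b) * (C2 * (C1 * ∫⁻ x, (g x / W x) ^ (1 / b) ∂μ)) := by
        gcongr; exact H1 _ (by fun_prop)
    _ = (K ^ (1 / a)) ^ (1 / b) * (C2 * (C1 * ∫⁻ x, g x ^ (1 / b) * S x)) := by
        congr 3
        rw [hμ, lintegral_withDensity_eq_lintegral_mul _ hWm (by fun_prop)]
        refine lintegral_congr fun x => ?_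
        simp only [Pi.mul_apply]
        rw [ENNReal.div_rpow_of_nonneg _ _ (by positivity), hSeq x]
        have h2 : W x ^ (-(a / b)) = W x * (W x ^ (1 / b))⁻¹ := by
          rw [← ENNReal.rpow_neg]
          nth_rewrite 2 [← ENNReal.rpow_one (W x)]
          rw [← ENNReal.rpow_add _ _ (hW0 x) (hWt x)]; congr 1; field_simp; linarith
        rw [h2, div_eq_mul_inv]; ring
    _ = _ := by ring


lemma lintegral_cube_ne_top {n : ℕ} {w : (Fin n → ℝ) → ℝ} (hw : LocallyIntegrable w volume)
    {Q : Set (Fin n → ℝ)} (hQ : IsCube Q) : ∫⁻ x in Q, ENNReal.ofReal (w x) ≠ ⊤ := by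
  obtain ⟨c, r, hr, rfl⟩ := hQ.exists_ball
  have h : IntegrableOn w (Metric.closedBall c r) :=
    hw.integrableOn_isCompact (isCompact_closedBall c r)
  refine ((lintegral_mono fun x => ?_).trans_lt h.2).ne
  rw [← ofReal_norm]
  exact ENNReal.ofReal_le_ofReal (Real.le_norm_self _)

lemma lintegral_cube_ne_zero {n : ℕ} {W : (Fin n → ℝ) → ℝ≥0∞} (hm : Measurable W)
    (hw : ∀ x, W x ≠ 0) {Q : Set (Fin n → ℝ)} (hQ : IsCube Q) : ∫⁻ x in Q, W x ≠ 0 := by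
  have := openPos_wd W hm hw
  have h := hQ.measure_ne_zero (volume.withDensity W)
  rwa [withDensity_apply _ hQ.measurableSet] at h

lemma dual_finite {n : ℕ} {p : ℝ} (hp : 1 < p) {w : (Fin n → ℝ) → ℝ} (hm : Measurable w)
    (hpos : ∀ x, 0 < w x) (hw : MemAp p w) {Q : Set (Fin n → ℝ)} (hQ : IsCube Q) :
    ∫⁻ x in Q, ENNReal.ofReal (w x ^ (-(1 / (p - 1)))) ≠ ⊤ := by
  intro htop
  apply hw.2
  have h1 : avg Q w * (avg Q (fun x => w x ^ (-(1 / (p - 1))))) ^ (p - 1) ≤ apCharE p w :=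
    le_iSup_of_le Q (le_iSup_of_le hQ le_rfl)
  have v0 := hQ.measure_ne_zero (volume : Measure (Fin n → ℝ))
  have vt := hQ.measure_ne_top (volume : Measure (Fin n → ℝ))
  have h2 : avg Q (fun x => w x ^ (-(1 / (p - 1)))) = ⊤ := by
    unfold avg; rw [htop, ENNReal.top_div_of_ne_top vt]
  have h3 : avg Q w ≠ 0 := by
    unfold avg
    refine (ENNReal.div_pos (lintegral_cube_ne_zero (W := fun x => ENNReal.ofReal (w x))
      (by fun_prop) (fun x => by simpa using hpos x) hQ) vt).ne'
  rw [h2, ENNReal.top_rpow_of_pos (by linarith), ENNReal.mul_top h3] at h1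
  exact top_unique h1

lemma max_bound {n : ℕ} {p : ℝ} (hp : 1 < p) {w : (Fin n → ℝ) → ℝ} (hm : Measurable w)
    (hpos : ∀ x, 0 < w x) (hw : MemAp p w) :
    ∃ C : ℝ≥0∞, C ≠ ⊤ ∧ ∀ g : (Fin n → ℝ) → ℝ≥0∞, Measurable g →
      ∫⁻ x, MQ volume g x ^ (p / (p - 1)) * ENNReal.ofReal (w x ^ (1 - p / (p - 1))) ≤
        C * ∫⁻ x, g x ^ (p / (p - 1)) * ENNReal.ofReal (w x ^ (1 - p / (p - 1))) := by
  have hp1 : 0 < p - 1 := by linarith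
  have hp0 : 0 < p := by linarith
  have hexp : 1 - p / (p - 1) = -(1 / (p - 1)) := by field_simp; ring
  rw [hexp]
  have hr : p / (p - 1) = 1 / ((p - 1) / p) := by field_simp
  rw [hr]
  refine muckenhoupt (fun x => ENNReal.ofReal (w x))
    (fun x => ENNReal.ofReal (w x ^ (-(1 / (p - 1))))) (by fun_prop) (by fun_prop)
    (fun x => by simpa using hpos x) (fun x => ofReal_ne_top)
    (fun x => by simpa using Real.rpow_pos_of_pos (hpos x) _) (fun x => ofReal_ne_top)
    (1 / p) ((p - 1) / p) (by positivity) (by positivity) (by field_simp; ring) ?_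
    (apCharE p w ^ (1 / p)) (ENNReal.rpow_ne_top_of_nonneg (by positivity) hw.2)
    (fun Q hQ => lintegral_cube_ne_top hw.1.2 hQ) (fun Q hQ => dual_finite hp hm hpos hw hQ) ?_
  · intro x
    have h0 := hpos x
    rw [ENNReal.ofReal_rpow_of_pos h0, ENNReal.ofReal_rpow_of_pos (Real.rpow_pos_of_pos h0 _),
      ← ENNReal.ofReal_mul (by positivity), ← Real.rpow_mul h0.le, ← Real.rpow_add h0]
    have : 1 / p + -(1 / (p - 1)) * ((p - 1) / p) = 0 := by field_simp; ring
    rw [this]; simp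
  · intro Q hQ
    have v0 := hQ.measure_ne_zero (volume : Measure (Fin n → ℝ))
    have vt := hQ.measure_ne_top (volume : Measure (Fin n → ℝ))
    have h1 : avg Q w * (avg Q (fun x => w x ^ (-(1 / (p - 1))))) ^ (p - 1) ≤ apCharE p w :=
      le_iSup_of_le Q (le_iSup_of_le hQ le_rfl)
    have h2 := ENNReal.rpow_le_rpow h1 (z := 1 / p) (by positivity)
    rw [ENNReal.mul_rpow_of_nonneg _ _ (by positivity), ← ENNReal.rpow_mul, mul_one_div] at h2
    unfold avg at h2
    have e1 : ∫⁻ x in Q, ENNReal.ofReal (w x) =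
        ((∫⁻ x in Q, ENNReal.ofReal (w x)) / volume Q) * volume Q :=
      (ENNReal.div_mul_cancel v0 vt).symm
    have e2 : ∫⁻ x in Q, ENNReal.ofReal (w x ^ (-(1 / (p - 1)))) =
        ((∫⁻ x in Q, ENNReal.ofReal (w x ^ (-(1 / (p - 1))))) / volume Q) * volume Q :=
      (ENNReal.div_mul_cancel v0 vt).symm
    have e3 : volume Q = volume Q ^ (1 / p) * volume Q ^ ((p - 1) / p) := by
      rw [← ENNReal.rpow_add _ _ v0 vt]
      have : 1 / p + (p - 1) / p = 1 := by field_simp; ring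
      rw [this, ENNReal.rpow_one]
    rw [e1, e2, ENNReal.mul_rpow_of_nonneg _ _ (by positivity),
      ENNReal.mul_rpow_of_nonneg _ _ (by positivity)]
    nth_rewrite 5 [e3]
    calc _ = (((∫⁻ x in Q, ENNReal.ofReal (w x)) / volume Q) ^ (1 / p) *
          ((∫⁻ x in Q, ENNReal.ofReal (w x ^ (-(1 / (p - 1))))) / volume Q) ^ ((p - 1) / p)) *
          (volume Q ^ (1 / p) * volume Q ^ ((p - 1) / p)) := by ring
      _ ≤ _ := by gcongr

lemma eLpNormW_eq {n : ℕ} {r : ℝ} (hr : 0 < r) (w f : (Fin n → ℝ) → ℝ) :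
    eLpNormW r w f = (∫⁻ x, ENNReal.ofReal |f x| ^ r * ENNReal.ofReal (w x)) ^ (1 / r) := by
  unfold eLpNormW
  congr 1
  refine lintegral_congr fun x => ?_
  rw [ENNReal.ofReal_rpow_of_nonneg (abs_nonneg _) hr.le]

lemma maximalE_eq {n : ℕ} (f : (Fin n → ℝ) → ℝ) (x : Fin n → ℝ) :
    maximalE f x = MQ volume (fun y => ENNReal.ofReal |f y|) x := rfl

lemma measurable_maximal {n : ℕ} (f : (Fin n → ℝ) → ℝ) : Measurable (maximal f) :=
  (measurable_MQ volume _).ennreal_toReal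

lemma maximal_bdd {n : ℕ} {p : ℝ} (hp : 1 < p) {w : (Fin n → ℝ) → ℝ} (hm : Measurable w)
    (hpos : ∀ x, 0 < w x) (hw : MemAp p w) :
    (∃ c : ℝ, 0 ≤ c ∧ StrongBound (p / (p - 1)) (fun x => w x ^ (1 - p / (p - 1))) maximal c) ∧
    (∀ f, MemLpW (p / (p - 1)) (fun x => w x ^ (1 - p / (p - 1))) f →
      ∀ᵐ x ∂(volume : Measure (Fin n → ℝ)), maximalE f x < ⊤) := by
  obtain ⟨C, hC, H⟩ := max_bound hp hm hpos hw
  have hp1 : 0 < p - 1 := by linarith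
  have hp0 : 0 < p := by linarith
  set r := p / (p - 1) with hr
  have hr0 : 0 < r := by positivity
  constructor
  · refine ⟨(C ^ (1 / r)).toReal, toReal_nonneg, fun f hf => ?_⟩
    rw [ENNReal.ofReal_toReal (ENNReal.rpow_ne_top_of_nonneg (by positivity) hC),
      eLpNormW_eq hr0, eLpNormW_eq hr0, ← ENNReal.mul_rpow_of_nonneg _ _ (by positivity)]
    refine ENNReal.rpow_le_rpow ?_ (by positivity)
    refine le_trans ?_ (H (fun y => ENNReal.ofReal |f y|) (by have := hf.1; fun_prop))
    refine lintegral_mono fun x => ?_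
    refine mul_le_mul' (ENNReal.rpow_le_rpow ?_ hr0.le) le_rfl
    rw [abs_of_nonneg (by exact toReal_nonneg)]
    exact ENNReal.ofReal_toReal_le
  · intro f hf
    have h1 := H (fun y => ENNReal.ofReal |f y|) (by have := hf.1; fun_prop)
    have h2 := hf.2
    rw [eLpNormW_eq hr0] at h2
    have h3 : (∫⁻ x, ENNReal.ofReal |f x| ^ r * ENNReal.ofReal (w x ^ (1 - r))) ≠ ⊤ := by
      intro h; rw [h, ENNReal.top_rpow_of_pos (by positivity)] at h2; exact h2 rfl
    have h4 := ne_top_of_le_ne_top (ENNReal.mul_ne_top hC h3) h1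
    have hmm := measurable_MQ volume (fun y => ENNReal.ofReal |f y|)
    filter_upwards [ae_lt_top (by fun_prop) h4] with x hx
    rw [maximalE_eq]
    by_contra h
    rw [not_lt, top_le_iff] at h
    rw [h, ENNReal.top_rpow_of_pos hr0, ENNReal.top_mul] at hx
    · exact lt_irrefl _ hx
    · simpa using Real.rpow_pos_of_pos (hpos x) _

lemma opNorm_spec {n : ℕ} {r : ℝ} (hr : 0 < r) {s : (Fin n → ℝ) → ℝ} (hsm : Measurable s)
    (hpos : ∀ x, 0 < s x)
    (hfin : ∀ Q : Set (Fin n → ℝ), IsCube Q → ∫⁻ x in Q, ENNReal.ofReal (s x) ≠ ⊤)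
    (hex : ∃ c : ℝ, 0 ≤ c ∧ StrongBound r s maximal c) :
    StrongBound r s maximal (opNorm r s maximal) ∧ 1 ≤ opNorm r s maximal := by
  have hS : StrongBound r s maximal (opNorm r s maximal) := by
    intro f hf
    have h : ∀ c ∈ { c : ℝ | 0 ≤ c ∧ StrongBound r s maximal c },
      eLpNormW r s (maximal f) ≤ ENNReal.ofReal c * eLpNormW r s f := fun c hc => hc.2 f hf
    obtain ⟨u, -, hu, hmem⟩ := exists_seq_tendsto_sInf (S := { c : ℝ | 0 ≤ c ∧ StrongBound r s maximal c })
      hex ⟨0, fun c hc => hc.1⟩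
    have ht : Tendsto (fun k => ENNReal.ofReal (u k) * eLpNormW r s f) atTop
        (nhds (ENNReal.ofReal (opNorm r s maximal) * eLpNormW r s f)) :=
      ENNReal.Tendsto.mul_const (ENNReal.tendsto_ofReal hu) (Or.inr hf.2)
    exact ge_of_tendsto' ht fun k => h _ (hmem k)
  refine ⟨hS, ?_⟩
  set Q : Set (Fin n → ℝ) := Metric.closedBall 0 1 with hQd
  have hQ : IsCube Q := isCube_closedBall 0 1 one_pos
  have hQm := hQ.measurableSet
  set f : (Fin n → ℝ) → ℝ := Q.indicator (fun _ => 1) with hf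
  have hfm : Measurable f := measurable_const.indicator hQm
  have hfo : ∀ y, ENNReal.ofReal |f y| = Q.indicator (fun _ => 1) y := by
    intro y; simp only [hf, indicator]; split_ifs <;> simp
  have hnorm : eLpNormW r s f = (∫⁻ x in Q, ENNReal.ofReal (s x)) ^ (1 / r) := by
    rw [eLpNormW_eq hr, ← lintegral_indicator hQm]
    congr 1
    refine lintegral_congr fun x => ?_
    rw [hfo]; simp only [indicator]
    split_ifs
    · simp
    · simp [hr]
  have I0 := lintegral_cube_ne_zero (W := fun x => ENNReal.ofReal (s x)) (by fun_prop)
      (fun x => by simpa using hpos x) hQ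
  have It := hfin Q hQ
  have n0 : eLpNormW r s f ≠ 0 := by
    rw [hnorm]; exact (ENNReal.rpow_pos (pos_iff_ne_zero.2 I0) It).ne'
  have nt : eLpNormW r s f ≠ ⊤ := by
    rw [hnorm]; exact ENNReal.rpow_ne_top_of_nonneg (by positivity) It
  have v0 := hQ.measure_ne_zero (volume : Measure (Fin n → ℝ))
  have vt := hQ.measure_ne_top (volume : Measure (Fin n → ℝ))
  have hmax : ∀ x, ENNReal.ofReal |f x| ≤ ENNReal.ofReal |maximal f x| := by
    intro x
    have hle : maximalE f x ≤ 1 := by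
      refine iSup_le fun P => iSup_le fun hP => iSup_le fun hx => ?_
      unfold avg
      refine ENNReal.div_le_of_le_mul ?_
      rw [← setLIntegral_const]
      refine lintegral_mono fun y => ?_
      rw [hfo]; exact indicator_le_self' (fun _ _ => zero_le_one) y
    have hge : ENNReal.ofReal |f x| ≤ maximalE f x := by
      rw [hfo]
      by_cases hx : x ∈ Q
      · rw [indicator_of_mem hx, maximalE_eq]
        refine le_trans (le_of_eq ?_) (le_MQ volume _ hQ hx)
        simp_rw [hfo]
        rw [lintegral_indicator hQm, Measure.restrict_restrict hQm, inter_self]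
        simp only [lintegral_const, Measure.restrict_apply, MeasurableSet.univ, univ_inter, one_mul]
        rw [ENNReal.div_self v0 vt]
      · rw [indicator_of_notMem hx]; exact zero_le
    unfold maximal
    rw [abs_of_nonneg toReal_nonneg, ENNReal.ofReal_toReal (ne_top_of_le_ne_top one_ne_top hle)]
    exact hge
  have h1 : eLpNormW r s f ≤ eLpNormW r s (maximal f) := by
    rw [eLpNormW_eq hr, eLpNormW_eq hr]
    refine ENNReal.rpow_le_rpow (lintegral_mono fun x => ?_) (by positivity)
    exact mul_le_mul' (ENNReal.rpow_le_rpow (hmax x) hr.le) le_rfl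
  have h2 := h1.trans (hS f ⟨hfm, nt⟩)
  by_contra hlt
  rw [not_le] at hlt
  have h3 : ENNReal.ofReal (opNorm r s maximal) < 1 := by simpa using hlt
  have h4 := ENNReal.mul_lt_mul_left n0 nt h3
  rw [one_mul] at h4
  exact absurd h2 (not_le.2 h4)


lemma minkowski_tsum {α : Type*} [MeasurableSpace α] (ν : Measure α) {r : ℝ} (hr : 1 ≤ r)
    (g : ℕ → α → ℝ≥0∞) (hg : ∀ k, Measurable (g k)) :
    (∫⁻ x, (∑' k, g k x) ^ r ∂ν) ^ (1 / r) ≤ ∑' k, (∫⁻ x, g k x ^ r ∂ν) ^ (1 / r) := by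
  have hr0 : 0 < r := by linarith
  have hfin : ∀ m : ℕ, (∫⁻ x, (∑ k ∈ Finset.range m, g k x) ^ r ∂ν) ^ (1 / r) ≤
      ∑ k ∈ Finset.range m, (∫⁻ x, g k x ^ r ∂ν) ^ (1 / r) := by
    intro m
    induction m with
    | zero => simp [hr0]
    | succ m ih =>
      rw [Finset.sum_range_succ]
      simp_rw [Finset.sum_range_succ]
      have h := ENNReal.lintegral_Lp_add_le (μ := ν) (f := fun x => ∑ k ∈ Finset.range m, g k x)
        (g := g m) (Finset.measurable_sum _ fun k _ => hg k).aemeasurable (hg m).aemeasurable hr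
      simp only [Pi.add_apply] at h
      exact h.trans (by gcongr)
  have hlim : Tendsto (fun m : ℕ => ∫⁻ x, (∑ k ∈ Finset.range m, g k x) ^ r ∂ν) atTop
      (nhds (∫⁻ x, (∑' k, g k x) ^ r ∂ν)) := by
    refine lintegral_tendsto_of_tendsto_of_monotone (fun m => ?_) ?_ ?_
    · exact ((Finset.measurable_sum _ fun k _ => hg k).pow_const r).aemeasurable
    · refine Eventually.of_forall fun x m m' hmm => ?_
      refine ENNReal.rpow_le_rpow ?_ hr0.le
      exact Finset.sum_le_sum_of_subset (Finset.range_mono hmm)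
    · refine Eventually.of_forall fun x => ?_
      exact (ENNReal.continuous_rpow_const.tendsto _).comp (ENNReal.tendsto_nat_tsum _)
  have hlim2 := (ENNReal.continuous_rpow_const (y := 1 / r)).tendsto _ |>.comp hlim
  exact le_of_tendsto' hlim2 fun m => (hfin m).trans (ENNReal.sum_le_tsum _)

lemma MQ_pos {n : ℕ} (g : (Fin n → ℝ) → ℝ≥0∞) (hg : ∫⁻ x, g x ≠ 0) (x : Fin n → ℝ) :
    0 < MQ volume g x := by
  rw [pos_iff_ne_zero]
  intro h0
  apply hg
  have h1 : ∀ k : ℕ, ∫⁻ y in Metric.closedBall x (k + 1), g y = 0 := by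
    intro k
    have hk : (0 : ℝ) < k + 1 := by positivity
    have hQ := isCube_closedBall x _ hk
    have h := le_MQ volume g hQ (Metric.mem_closedBall_self hk.le)
    rw [h0, nonpos_iff_eq_zero, ENNReal.div_eq_zero_iff] at h
    exact h.resolve_right (hQ.measure_ne_top volume)
  have h2 : (⋃ k : ℕ, Metric.closedBall x ((k : ℝ) + 1)) = univ := by
    refine eq_univ_of_forall fun y => ?_
    obtain ⟨k, hk⟩ := exists_nat_ge (dist y x)
    exact mem_iUnion.2 ⟨k, by rw [Metric.mem_closedBall]; linarith⟩
  rw [← setLIntegral_univ, ← h2, ← nonpos_iff_eq_zero]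
  refine (lintegral_iUnion_le _ _).trans ?_
  simp [h1]

/-- Rubio de Francia iteration algorithm. -/
lemma rubio {n : ℕ} {r : ℝ} (hr : 1 < r) {s : (Fin n → ℝ) → ℝ} (hsm : Measurable s)
    (hpos : ∀ x, 0 < s x) {N ε : ℝ} (hN : 1 ≤ N) (hε : 0 < ε) (hb : StrongBound r s maximal N)
    (hfin : ∀ f, MemLpW r s f → ∀ᵐ x ∂(volume : Measure (Fin n → ℝ)), maximalE f x < ⊤)
    (φ : (Fin n → ℝ) → ℝ) (hφ : MemLpW r s φ) (hφ0 : ∀ x, 0 ≤ φ x)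
    (hne : ∫⁻ x, ENNReal.ofReal (φ x) ≠ 0) :
    ∃ u : (Fin n → ℝ) → ℝ, Measurable u ∧ (∀ x, 0 < u x) ∧
      (∀ᵐ x ∂(volume : Measure (Fin n → ℝ)), φ x ≤ u x) ∧
      (∀ᵐ x ∂(volume : Measure (Fin n → ℝ)),
        maximalE u x ≤ ENNReal.ofReal ((1 + ε) * N) * ENNReal.ofReal (u x)) ∧
      eLpNormW r s u ≤ ENNReal.ofReal ((1 + ε) / ε) * eLpNormW r s φ := by
  have hr0 : 0 < r := by linarith
  set c : ℝ := (1 + ε) * N with hc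
  have hc0 : 0 < c := by positivity
  set C : ℝ≥0∞ := ENNReal.ofReal c with hC
  have hC0 : C ≠ 0 := by simpa [hC] using hc0
  have hCt : C ≠ ⊤ := ofReal_ne_top
  set Φ : ℕ → (Fin n → ℝ) → ℝ := fun k => maximal^[k] φ with hΦ
  have hΦs : ∀ k, Φ (k + 1) = maximal (Φ k) := fun k => Function.iterate_succ_apply' _ _ _
  have hΦ0 : ∀ k x, 0 ≤ Φ k x := by
    intro k x
    cases k with
    | zero => exact hφ0 x
    | succ k => rw [hΦs]; exact toReal_nonneg
  have hΦm : ∀ k, MemLpW r s (Φ k) ∧ eLpNormW r s (Φ k) ≤ ENNReal.ofReal N ^ k * eLpNormW r s φ := by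
    intro k
    induction k with
    | zero => exact ⟨hφ, by simp [hΦ]⟩
    | succ k ih =>
      have h1 := hb _ ih.1
      rw [hΦs]
      refine ⟨⟨measurable_maximal _, ne_top_of_le_ne_top
        (ENNReal.mul_ne_top ofReal_ne_top ih.1.2) h1⟩, h1.trans ?_⟩
      calc _ ≤ ENNReal.ofReal N * (ENNReal.ofReal N ^ k * eLpNormW r s φ) := by gcongr; exact ih.2
        _ = _ := by rw [pow_succ]; ring
  set g : ℕ → (Fin n → ℝ) → ℝ≥0∞ := fun k x => (C⁻¹) ^ k * ENNReal.ofReal (Φ k x) with hg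
  have hgm : ∀ k, Measurable (g k) := by
    intro k; have := (hΦm k).1.1; fun_prop
  set U : (Fin n → ℝ) → ℝ≥0∞ := fun x => ∑' k, g k x with hU
  have hUm : Measurable U := Measurable.tsum hgm
  have hSm : Measurable (fun x => ENNReal.ofReal (s x)) := by fun_prop
  have hnU : (∫⁻ x, U x ^ r * ENNReal.ofReal (s x)) ^ (1 / r) ≤
      ENNReal.ofReal ((1 + ε) / ε) * eLpNormW r s φ := by
    have h1 := minkowski_tsum (volume.withDensity fun x => ENNReal.ofReal (s x)) hr.le g hgm
    have e : ∀ h : (Fin n → ℝ) → ℝ≥0∞, Measurable h →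
        ∫⁻ x, h x ^ r ∂(volume.withDensity fun x => ENNReal.ofReal (s x)) =
        ∫⁻ x, h x ^ r * ENNReal.ofReal (s x) := by
      intro h hh
      rw [lintegral_withDensity_eq_lintegral_mul _ hSm (by fun_prop)]
      refine lintegral_congr fun x => ?_
      simp only [Pi.mul_apply]; ring
    rw [e U hUm] at h1
    refine h1.trans ?_
    have h2 : ∀ k, (∫⁻ x, g k x ^ r ∂(volume.withDensity fun x => ENNReal.ofReal (s x))) ^ (1 / r)
        ≤ ENNReal.ofReal ((1 + ε)⁻¹) ^ k * eLpNormW r s φ := by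
      intro k
      rw [e _ (hgm k)]
      have h3 : ∫⁻ x, g k x ^ r * ENNReal.ofReal (s x) =
          ((C⁻¹) ^ k) ^ r * ∫⁻ x, ENNReal.ofReal |Φ k x| ^ r * ENNReal.ofReal (s x) := by
        rw [← lintegral_const_mul _ (by have := (hΦm k).1.1; fun_prop)]
        refine lintegral_congr fun x => ?_
        simp only [hg]
        rw [ENNReal.mul_rpow_of_nonneg _ _ hr0.le, abs_of_nonneg (hΦ0 k x), mul_assoc]
      rw [h3, ENNReal.mul_rpow_of_nonneg _ _ (by positivity), ← eLpNormW_eq hr0,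
        ← ENNReal.rpow_mul, mul_one_div_cancel hr0.ne', ENNReal.rpow_one]
      refine (mul_le_mul' le_rfl (hΦm k).2).trans (le_of_eq ?_)
      rw [← mul_assoc, ← mul_pow, hC, ← ENNReal.ofReal_inv_of_pos hc0,
        ← ENNReal.ofReal_mul (by positivity)]
      congr 3
      rw [hc]; field_simp
    refine (ENNReal.tsum_le_tsum h2).trans (le_of_eq ?_)
    rw [ENNReal.tsum_mul_right, ENNReal.tsum_geometric]
    congr 1
    rw [← ENNReal.ofReal_one, ← ENNReal.ofReal_sub _ (by positivity), ← ENNReal.ofReal_inv_of_pos]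
    · have h5 : 1 - (1 + ε)⁻¹ = ε / (1 + ε) := by field_simp; ring
      rw [h5, inv_div]
    · rw [sub_pos]; exact inv_lt_one_of_one_lt₀ (by linarith)
  have hUfin : ∀ᵐ x ∂(volume : Measure (Fin n → ℝ)), U x < ⊤ := by
    have h1 : (∫⁻ x, U x ^ r * ENNReal.ofReal (s x)) ≠ ⊤ := by
      intro h
      rw [h, ENNReal.top_rpow_of_pos (by positivity)] at hnU
      exact ENNReal.mul_ne_top ofReal_ne_top hφ.2 (top_unique hnU)
    filter_upwards [ae_lt_top (by fun_prop) h1] with x hx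
    by_contra h
    rw [not_lt, top_le_iff] at h
    rw [h, ENNReal.top_rpow_of_pos hr0, ENNReal.top_mul] at hx
    · exact lt_irrefl _ hx
    · simpa using hpos x
  have hUpos : ∀ᵐ x ∂(volume : Measure (Fin n → ℝ)), U x ≠ 0 := by
    filter_upwards [hfin φ hφ] with x hx
    have h1 : g 1 x ≤ U x := ENNReal.le_tsum 1
    have h2 : 0 < maximalE φ x := by
      rw [maximalE_eq]; refine MQ_pos _ ?_ x
      simp_rw [abs_of_nonneg (hφ0 _)]; exact hne
    have h3 : g 1 x ≠ 0 := by
      simp only [hg, pow_one]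
      refine mul_ne_zero (ENNReal.inv_ne_zero.2 hCt) ?_
      have : Φ 1 x = (maximalE φ x).toReal := rfl
      rw [this, ENNReal.ofReal_toReal hx.ne]; exact h2.ne'
    exact (lt_of_lt_of_le (pos_iff_ne_zero.2 h3) h1).ne'
  classical
  set u : (Fin n → ℝ) → ℝ := fun x => if 0 < (U x).toReal then (U x).toReal else 1 with hu
  have hum : Measurable u := by
    refine Measurable.ite ?_ hUm.ennreal_toReal measurable_const
    exact measurableSet_lt measurable_const hUm.ennreal_toReal
  have hu0 : ∀ x, 0 < u x := by
    intro x; simp only [hu]; split_ifs with h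
    · exact h
    · exact one_pos
  have huU : ∀ᵐ x ∂(volume : Measure (Fin n → ℝ)), ENNReal.ofReal (u x) = U x := by
    filter_upwards [hUfin, hUpos] with x h1 h2
    simp only [hu]
    rw [if_pos (ENNReal.toReal_pos h2 h1.ne), ENNReal.ofReal_toReal h1.ne]
  refine ⟨u, hum, hu0, ?_, ?_, ?_⟩
  · filter_upwards [huU] with x hx
    have h1 : g 0 x ≤ U x := ENNReal.le_tsum 0
    rw [← hx] at h1
    simp only [hg, pow_zero, one_mul] at h1
    exact (ENNReal.ofReal_le_ofReal_iff (hu0 x).le).1 h1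
  · have hall : ∀ᵐ x ∂(volume : Measure (Fin n → ℝ)), ∀ k, maximalE (Φ k) x < ⊤ :=
      ae_all_iff.2 fun k => hfin _ (hΦm k).1
    filter_upwards [huU, hall] with x hx hk
    rw [hx, maximalE_eq]
    refine iSup_le fun Q => iSup_le fun hQ => iSup_le fun hxQ => ?_
    have e1 : ∫⁻ y in Q, ENNReal.ofReal |u y| = ∑' k, ∫⁻ y in Q, g k y := by
      rw [← lintegral_tsum fun k => (hgm k).aemeasurable]
      refine lintegral_congr_ae (ae_restrict_of_ae ?_)
      filter_upwards [huU] with y hy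
      rw [abs_of_pos (hu0 y), hy]
    rw [e1, div_eq_mul_inv, ← ENNReal.tsum_mul_right]
    have h1 : ∀ k, (∫⁻ y in Q, g k y) * (volume Q)⁻¹ ≤ C * g (k + 1) x := by
      intro k
      have h2 : (∫⁻ y in Q, g k y) = (C⁻¹) ^ k * ∫⁻ y in Q, ENNReal.ofReal |Φ k y| := by
        rw [← lintegral_const_mul _ (by have := (hΦm k).1.1; fun_prop)]
        refine lintegral_congr fun y => ?_
        simp only [hg]; rw [abs_of_nonneg (hΦ0 k y)]
      have h3 : ENNReal.ofReal (Φ (k + 1) x) = maximalE (Φ k) x := by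
        rw [hΦs]; exact ENNReal.ofReal_toReal (hk k).ne
      have h4 : C * g (k + 1) x = (C⁻¹) ^ k * maximalE (Φ k) x := by
        simp only [hg]
        rw [h3, pow_succ]
        calc C * (C⁻¹ ^ k * C⁻¹ * maximalE (Φ k) x) = (C * C⁻¹) * (C⁻¹ ^ k * maximalE (Φ k) x) := by
              ring
          _ = _ := by rw [ENNReal.mul_inv_cancel hC0 hCt, one_mul]
      rw [h4, h2, mul_assoc, ← div_eq_mul_inv, maximalE_eq]
      gcongr
      exact le_MQ volume _ hQ hxQ
    refine (ENNReal.tsum_le_tsum h1).trans ?_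
    rw [ENNReal.tsum_mul_left]
    gcongr
    exact ENNReal.tsum_comp_le_tsum_of_injective (add_left_injective 1) fun k => g k x
  · refine le_trans (le_of_eq ?_) hnU
    rw [eLpNormW_eq hr0]
    congr 1
    refine lintegral_congr_ae ?_
    filter_upwards [huU] with x hx
    rw [abs_of_pos (hu0 x), hx]


lemma one_le_apCharE {n : ℕ} {p : ℝ} (hp : 1 < p) {v : (Fin n → ℝ) → ℝ} (hm : Measurable v)
    (hpos : ∀ x, 0 < v x) : 1 ≤ apCharE p v := by
  have hp1 : 0 < p - 1 := by linarith
  have hp0 : 0 < p := by linarith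
  set Q : Set (Fin n → ℝ) := Metric.closedBall 0 1 with hQd
  have hQ : IsCube Q := isCube_closedBall 0 1 one_pos
  have v0 := hQ.measure_ne_zero (volume : Measure (Fin n → ℝ))
  have vt := hQ.measure_ne_top (volume : Measure (Fin n → ℝ))
  refine le_trans ?_ (le_iSup_of_le Q (le_iSup_of_le hQ le_rfl))
  have hab : 1 / p + (p - 1) / p = 1 := by field_simp; ring
  have h1 : volume Q ≤ (∫⁻ x in Q, ENNReal.ofReal (v x)) ^ (1 / p) *
      (∫⁻ x in Q, ENNReal.ofReal (v x ^ (-(1 / (p - 1))))) ^ ((p - 1) / p) := by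
    refine le_trans (le_of_eq ?_) (ENNReal.lintegral_mul_norm_pow_le
      (μ := volume.restrict Q) (f := fun x => ENNReal.ofReal (v x))
      (g := fun x => ENNReal.ofReal (v x ^ (-(1 / (p - 1))))) (by fun_prop) (by fun_prop)
      (by positivity) (by positivity) hab)
    have : ∀ x, ENNReal.ofReal (v x) ^ (1 / p) *
        ENNReal.ofReal (v x ^ (-(1 / (p - 1)))) ^ ((p - 1) / p) = 1 := by
      intro x
      have h0 := hpos x
      rw [ENNReal.ofReal_rpow_of_pos h0, ENNReal.ofReal_rpow_of_pos (Real.rpow_pos_of_pos h0 _),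
        ← ENNReal.ofReal_mul (by positivity), ← Real.rpow_mul h0.le, ← Real.rpow_add h0]
      have : 1 / p + -(1 / (p - 1)) * ((p - 1) / p) = 0 := by field_simp; ring
      rw [this]; simp
    rw [lintegral_congr this]; simp
  have e1 : ∫⁻ x in Q, ENNReal.ofReal (v x) = avg Q v * volume Q :=
    (ENNReal.div_mul_cancel v0 vt).symm
  have e2 : ∫⁻ x in Q, ENNReal.ofReal (v x ^ (-(1 / (p - 1)))) =
      avg Q (fun x => v x ^ (-(1 / (p - 1)))) * volume Q :=
    (ENNReal.div_mul_cancel v0 vt).symm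
  have e3 : volume Q ^ (1 / p) * volume Q ^ ((p - 1) / p) = volume Q := by
    rw [← ENNReal.rpow_add _ _ v0 vt, hab, ENNReal.rpow_one]
  rw [e1, e2, ENNReal.mul_rpow_of_nonneg _ _ (by positivity),
    ENNReal.mul_rpow_of_nonneg _ _ (by positivity), mul_mul_mul_comm, e3] at h1
  have h2 : 1 ≤ avg Q v ^ (1 / p) * avg Q (fun x => v x ^ (-(1 / (p - 1)))) ^ ((p - 1) / p) := by
    refine (ENNReal.mul_le_mul_iff_left v0 vt).1 ?_
    rwa [one_mul]
  have h3 := ENNReal.rpow_le_rpow h2 hp0.le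
  rw [ENNReal.one_rpow, ENNReal.mul_rpow_of_nonneg _ _ hp0.le, ← ENNReal.rpow_mul,
    ← ENNReal.rpow_mul, div_mul_cancel₀ _ hp0.ne', div_mul_cancel₀ _ hp0.ne',
    ENNReal.rpow_one] at h3
  exact h3

lemma weight_bound {n : ℕ} {p p₀ c : ℝ} (hp₀ : 1 < p₀) (hp : p₀ < p) (hc : 0 < c)
    {w u : (Fin n → ℝ) → ℝ} (hm : Measurable w) (hpos : ∀ x, 0 < w x) (hw : MemAp p w)
    (hum : Measurable u) (hu0 : ∀ x, 0 < u x)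
    (hu : ∀ᵐ x ∂(volume : Measure (Fin n → ℝ)),
        maximalE u x ≤ ENNReal.ofReal c * ENNReal.ofReal (u x)) :
    MemAp p₀ (fun x => w x ^ ((p₀ - 1) / (p - 1)) * u x ^ ((p - p₀) / (p - 1))) ∧
    1 ≤ apChar p₀ (fun x => w x ^ ((p₀ - 1) / (p - 1)) * u x ^ ((p - p₀) / (p - 1))) ∧
    apChar p₀ (fun x => w x ^ ((p₀ - 1) / (p - 1)) * u x ^ ((p - p₀) / (p - 1))) ≤
      c ^ ((p - p₀) / (p - 1)) * apChar p w ^ ((p₀ - 1) / (p - 1)) := by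
  have hp1 : 0 < p - 1 := by linarith
  have hp01 : 0 < p₀ - 1 := by linarith
  have hpp : 0 < p - p₀ := by linarith
  set θ := (p - p₀) / (p - 1) with hθ
  set η := (p₀ - 1) / (p - 1) with hη
  have hθ0 : 0 < θ := by positivity
  have hη0 : 0 < η := by positivity
  have hηθ : η + θ = 1 := by rw [hη, hθ]; field_simp; ring
  set v : (Fin n → ℝ) → ℝ := fun x => w x ^ η * u x ^ θ with hv
  have hvm : Measurable v := by fun_prop
  have hv0 : ∀ x, 0 < v x := fun x =>
    mul_pos (Real.rpow_pos_of_pos (hpos x) _) (Real.rpow_pos_of_pos (hu0 x) _)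
  set C := ENNReal.ofReal c with hC
  have hC0 : C ≠ 0 := by simpa [hC] using hc
  have hCt : C ≠ ⊤ := ofReal_ne_top
  -- facts about averages of u
  have hm0 : ∀ Q : Set (Fin n → ℝ), IsCube Q → avg Q u ≠ 0 := by
    intro Q hQ
    exact (ENNReal.div_pos (lintegral_cube_ne_zero (W := fun x => ENNReal.ofReal (u x))
      (by fun_prop) (fun x => by simpa using hu0 x) hQ) (hQ.measure_ne_top volume)).ne'
  have hle : ∀ Q : Set (Fin n → ℝ), IsCube Q →
      ∀ᵐ x ∂(volume.restrict Q), avg Q u ≤ C * ENNReal.ofReal (u x) := by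
    intro Q hQ
    refine (ae_restrict_iff' hQ.measurableSet).2 ?_
    filter_upwards [hu] with x hx hxQ
    refine le_trans ?_ hx
    have := le_MQ volume (fun y => ENNReal.ofReal |u y|) hQ hxQ
    simp_rw [abs_of_pos (hu0 _)] at this
    rw [maximalE_eq]
    simp_rw [abs_of_pos (hu0 _)]
    exact this
  have hmt : ∀ Q : Set (Fin n → ℝ), IsCube Q → avg Q u ≠ ⊤ := by
    intro Q hQ
    have : (ae (volume.restrict Q)).NeBot := by
      rw [ae_neBot]
      intro h
      exact hQ.measure_ne_zero volume (Measure.restrict_eq_zero.1 h)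
    obtain ⟨x, hx⟩ := (hle Q hQ).exists
    exact ne_top_of_le_ne_top (ENNReal.mul_ne_top hCt ofReal_ne_top) hx
  have hvE : ∀ x, ENNReal.ofReal (v x) = ENNReal.ofReal (w x) ^ η * ENNReal.ofReal (u x) ^ θ := by
    intro x
    simp only [hv]
    rw [ENNReal.ofReal_mul (Real.rpow_pos_of_pos (hpos x) _).le, ENNReal.ofReal_rpow_of_pos (hpos x),
      ENNReal.ofReal_rpow_of_pos (hu0 x)]
  have hav : ∀ Q : Set (Fin n → ℝ), IsCube Q → avg Q v ≤ avg Q w ^ η * avg Q u ^ θ := by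
    intro Q hQ
    have v0 := hQ.measure_ne_zero (volume : Measure (Fin n → ℝ))
    have vt := hQ.measure_ne_top (volume : Measure (Fin n → ℝ))
    unfold avg
    rw [ENNReal.div_rpow_of_nonneg _ _ hη0.le, ENNReal.div_rpow_of_nonneg _ _ hθ0.le]
    refine ENNReal.div_le_of_le_mul ?_
    have h1 : ∫⁻ x in Q, ENNReal.ofReal (v x) ≤
        (∫⁻ x in Q, ENNReal.ofReal (w x)) ^ η * (∫⁻ x in Q, ENNReal.ofReal (u x)) ^ θ := by
      simp_rw [hvE]
      exact ENNReal.lintegral_mul_norm_pow_le (by fun_prop) (by fun_prop) hη0.le hθ0.le hηθ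
    refine h1.trans (le_of_eq ?_)
    have e3 : volume Q = volume Q ^ η * volume Q ^ θ := by
      rw [← ENNReal.rpow_add _ _ v0 vt, hηθ, ENNReal.rpow_one]
    nth_rewrite 3 [e3]
    rw [mul_mul_mul_comm, ENNReal.div_mul_cancel, ENNReal.div_mul_cancel]
    · exact (ENNReal.rpow_pos (pos_iff_ne_zero.2 v0) vt).ne'
    · exact ENNReal.rpow_ne_top_of_nonneg hθ0.le vt
    · exact (ENNReal.rpow_pos (pos_iff_ne_zero.2 v0) vt).ne'
    · exact ENNReal.rpow_ne_top_of_nonneg hη0.le vt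
  have hchar : apCharE p₀ v ≤ C ^ θ * apCharE p w ^ η := by
    refine iSup_le fun Q => iSup_le fun hQ => ?_
    have v0 := hQ.measure_ne_zero (volume : Measure (Fin n → ℝ))
    have vt := hQ.measure_ne_top (volume : Measure (Fin n → ℝ))
    set m := avg Q u with hmdef
    have m0 : m ≠ 0 := hm0 Q hQ
    have mt : m ≠ ⊤ := hmt Q hQ
    have d0 : m / C ≠ 0 := (ENNReal.div_pos m0 hCt).ne'
    have dt : m / C ≠ ⊤ := ENNReal.div_ne_top mt hC0
    have h2 : avg Q (fun x => v x ^ (-(1 / (p₀ - 1)))) ≤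
        (m / C) ^ (-(θ / (p₀ - 1))) * avg Q (fun x => w x ^ (-(1 / (p - 1)))) := by
      unfold avg
      rw [← mul_div_assoc]
      gcongr ?_ / _
      rw [← lintegral_const_mul _ (by fun_prop)]
      refine lintegral_mono_ae ?_
      filter_upwards [hle Q hQ] with x hx
      have hx2 : m / C ≤ ENNReal.ofReal (u x) := ENNReal.div_le_of_le_mul' hx
      have hx3 : ENNReal.ofReal (u x) ^ (-(θ / (p₀ - 1))) ≤ (m / C) ^ (-(θ / (p₀ - 1))) := by
        rw [ENNReal.rpow_neg, ENNReal.rpow_neg, ENNReal.inv_le_inv]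
        exact ENNReal.rpow_le_rpow hx2 (by positivity)
      have e : v x ^ (-(1 / (p₀ - 1))) = u x ^ (-(θ / (p₀ - 1))) * w x ^ (-(1 / (p - 1))) := by
        simp only [hv]
        rw [Real.mul_rpow (Real.rpow_pos_of_pos (hpos x) _).le (Real.rpow_pos_of_pos (hu0 x) _).le,
          ← Real.rpow_mul (hpos x).le, ← Real.rpow_mul (hu0 x).le, mul_comm]
        congr 2
        · ring
        · rw [hη]; field_simp
      rw [e, ENNReal.ofReal_mul (Real.rpow_pos_of_pos (hu0 x) _).le,
        ← ENNReal.ofReal_rpow_of_pos (hu0 x)]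
      gcongr
    have h3 : avg Q w * avg Q (fun x => w x ^ (-(1 / (p - 1)))) ^ (p - 1) ≤ apCharE p w :=
      le_iSup_of_le Q (le_iSup_of_le hQ le_rfl)
    calc avg Q v * avg Q (fun x => v x ^ (-(1 / (p₀ - 1)))) ^ (p₀ - 1)
        ≤ (avg Q w ^ η * m ^ θ) *
          ((m / C) ^ (-(θ / (p₀ - 1))) * avg Q (fun x => w x ^ (-(1 / (p - 1))))) ^ (p₀ - 1) := by
          gcongr
          exact hav Q hQ
      _ = (m ^ θ * (m / C) ^ (-θ)) *
          (avg Q w * avg Q (fun x => w x ^ (-(1 / (p - 1)))) ^ (p - 1)) ^ η := by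
          rw [ENNReal.mul_rpow_of_nonneg _ _ hp01.le, ENNReal.mul_rpow_of_nonneg _ _ hη0.le,
            ← ENNReal.rpow_mul, ← ENNReal.rpow_mul]
          have a1 : -(θ / (p₀ - 1)) * (p₀ - 1) = -θ := by field_simp
          have a2 : (p - 1) * η = p₀ - 1 := by rw [hη]; field_simp
          rw [a1, a2]; ring
      _ = C ^ θ * (avg Q w * avg Q (fun x => w x ^ (-(1 / (p - 1)))) ^ (p - 1)) ^ η := by
          congr 1
          have : m ^ θ = (m / C) ^ θ * C ^ θ := by
            rw [← ENNReal.mul_rpow_of_nonneg _ _ hθ0.le, ENNReal.div_mul_cancel hC0 hCt]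
          rw [this, mul_right_comm, ← ENNReal.rpow_add _ _ d0 dt]
          simp
      _ ≤ _ := by gcongr
  have hcharT : C ^ θ * apCharE p w ^ η ≠ ⊤ :=
    ENNReal.mul_ne_top (ENNReal.rpow_ne_top_of_nonneg hθ0.le hCt)
      (ENNReal.rpow_ne_top_of_nonneg hη0.le hw.2)
  have hvT : apCharE p₀ v ≠ ⊤ := ne_top_of_le_ne_top hcharT hchar
  refine ⟨⟨⟨Eventually.of_forall hv0, ?_⟩, hvT⟩, ?_, ?_⟩
  · intro x
    refine ⟨Metric.closedBall x 1, Metric.closedBall_mem_nhds x one_pos, hvm.aestronglyMeasurable, ?_⟩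
    have hQ := isCube_closedBall x 1 one_pos
    have h1 : avg (Metric.closedBall x 1) v ≠ ⊤ := by
      refine ne_top_of_le_ne_top (ENNReal.mul_ne_top (ENNReal.rpow_ne_top_of_nonneg hη0.le ?_)
        (ENNReal.rpow_ne_top_of_nonneg hθ0.le (hmt _ hQ))) (hav _ hQ)
      exact ENNReal.div_ne_top (lintegral_cube_ne_top hw.1.2 hQ) (hQ.measure_ne_zero volume)
    have h2 : ∫⁻ y in Metric.closedBall x 1, ENNReal.ofReal (v y) ≠ ⊤ := by
      intro h
      apply h1
      unfold avg
      rw [h, ENNReal.top_div_of_ne_top (hQ.measure_ne_top volume)]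
    refine lt_of_le_of_lt (lintegral_mono fun y => ?_) h2.lt_top
    rw [← ofReal_norm, Real.norm_of_nonneg (hv0 y).le]
  · have := ENNReal.toReal_mono hvT (one_le_apCharE hp₀ hvm hv0)
    simpa [apChar] using this
  · have := ENNReal.toReal_mono hcharT hchar
    rw [ENNReal.toReal_mul, ← ENNReal.toReal_rpow, ← ENNReal.toReal_rpow, hC,
      ENNReal.toReal_ofReal hc.le] at this
    exact this


lemma key_dual {n : ℕ} {p p₀ ε δ₀ N : ℝ} (hp₀ : 1 < p₀) (hp : p₀ < p) (hε : 0 < ε)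
    (F : ℝ → ℝ) 
    (hFmono : ∀ x y : ℝ, 1 ≤ x → x ≤ y → F x ≤ F y)
    (T : ((Fin n → ℝ) → ℝ) → (Fin n → ℝ) → ℝ)
    (hTpos : ∀ f x, 0 ≤ T f x)
    (hyp : ∀ v : (Fin n → ℝ) → ℝ, MemAp p₀ v → apChar p₀ v ≤ 1 + δ₀ →
      ∀ f, MemLpW p₀ v f →
        eLpNormW p₀ v (T f) ≤ ENNReal.ofReal (F (apChar p₀ v)) * eLpNormW p₀ v f)
    {w : (Fin n → ℝ) → ℝ} (hm : Measurable w) (hpos : ∀ x, 0 < w x) (hw : MemAp p w)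
    (hN : 1 ≤ N)
    (hb : StrongBound (p / (p - 1)) (fun x => w x ^ (1 - p / (p - 1))) maximal N)
    (hfin : ∀ f, MemLpW (p / (p - 1)) (fun x => w x ^ (1 - p / (p - 1))) f →
      ∀ᵐ x, maximalE f x < ⊤)
    (hflat : ((1 + ε) * N) ^ ((p - p₀) / (p - 1)) * apChar p w ^ ((p₀ - 1) / (p - 1)) ≤ 1 + δ₀)
    {f : (Fin n → ℝ) → ℝ} (hf : MemLpW p w f) (hf0 : ∀ x, 0 ≤ f x)
    {h : (Fin n → ℝ) → ℝ} (hhm : Measurable h) (hh0 : ∀ x, 0 ≤ h x)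
    (hI0 : ∫⁻ x, ENNReal.ofReal (h x) ^ (p / (p - p₀)) * ENNReal.ofReal (w x) ≠ 0)
    (hIt : ∫⁻ x, ENNReal.ofReal (h x) ^ (p / (p - p₀)) * ENNReal.ofReal (w x) ≠ ⊤) :
    ∫⁻ x, ENNReal.ofReal (T f x) ^ p₀ * (ENNReal.ofReal (h x) * ENNReal.ofReal (w x)) ≤
      ENNReal.ofReal (F (((1 + ε) * N) ^ ((p - p₀) / (p - 1)) *
        apChar p w ^ ((p₀ - 1) / (p - 1)))) ^ p₀ *
      (eLpNormW p w f ^ p₀ * (ENNReal.ofReal ((1 + ε) / ε) ^ ((p - p₀) / (p - 1)) *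
        (∫⁻ x, ENNReal.ofReal (h x) ^ (p / (p - p₀)) * ENNReal.ofReal (w x)) ^ ((p - p₀) / p))) := by
  have hp1 : 0 < p - 1 := by linarith
  have hpp0 : 0 < p := by linarith
  have hp00 : 0 < p₀ := by linarith
  have hp01 : 0 < p₀ - 1 := by linarith
  have hpp : 0 < p - p₀ := by linarith
  set I := ∫⁻ x, ENNReal.ofReal (h x) ^ (p / (p - p₀)) * ENNReal.ofReal (w x) with hI
  set B := ((1 + ε) * N) ^ ((p - p₀) / (p - 1)) * apChar p w ^ ((p₀ - 1) / (p - 1)) with hB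
  have hr1 : 1 < p / (p - 1) := by rw [lt_div_iff₀ hp1]; linarith
  set r := p / (p - 1) with hr
  have hr0 : 0 < r := by linarith
  set s : (Fin n → ℝ) → ℝ := fun x => w x ^ (1 - r) with hs
  have hsm : Measurable s := by fun_prop
  have hs0 : ∀ x, 0 < s x := fun x => Real.rpow_pos_of_pos (hpos x) _
  set φ : (Fin n → ℝ) → ℝ := fun x => h x ^ ((p - 1) / (p - p₀)) * w x with hφ
  have hφm : Measurable φ := by fun_prop
  have hφ0 : ∀ x, 0 ≤ φ x := fun x => mul_nonneg (Real.rpow_nonneg (hh0 x) _) (hpos x).le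
  have hφI : ∫⁻ x, ENNReal.ofReal |φ x| ^ r * ENNReal.ofReal (s x) = I := by
    refine lintegral_congr fun x => ?_
    rw [abs_of_nonneg (hφ0 x), ENNReal.ofReal_rpow_of_nonneg (hφ0 x) hr0.le,
      ENNReal.ofReal_rpow_of_nonneg (hh0 x) (by positivity),
      ← ENNReal.ofReal_mul (Real.rpow_nonneg (hφ0 x) _),
      ← ENNReal.ofReal_mul (Real.rpow_nonneg (hh0 x) _)]
    congr 1
    simp only [hφ, hs]
    rw [Real.mul_rpow (Real.rpow_nonneg (hh0 x) _) (hpos x).le, ← Real.rpow_mul (hh0 x), mul_assoc,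
      ← Real.rpow_add (hpos x)]
    have e1 : (p - 1) / (p - p₀) * r = p / (p - p₀) := by rw [hr]; field_simp
    rw [e1]; simp
  have hφn : eLpNormW r s φ = I ^ (1 / r) := by rw [eLpNormW_eq hr0, hφI]
  have hφL : MemLpW r s φ :=
    ⟨hφm, by rw [hφn]; exact ENNReal.rpow_ne_top_of_nonneg (by positivity) hIt⟩
  have hne : ∫⁻ x, ENNReal.ofReal (φ x) ≠ 0 := by
    intro h0
    rw [lintegral_eq_zero_iff (by fun_prop)] at h0
    apply hI0
    rw [← hφI, lintegral_eq_zero_iff (by fun_prop)]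
    filter_upwards [h0] with x hx
    rw [abs_of_nonneg (hφ0 x)]
    simp only [Pi.zero_apply] at hx ⊢
    rw [hx, ENNReal.zero_rpow_of_pos hr0, zero_mul]
  obtain ⟨u, hum, hu0, hφu, huM, hun⟩ := rubio hr1 hsm hs0 hN hε hb hfin φ hφL hφ0 hne
  have hc : 0 < (1 + ε) * N := by positivity
  obtain ⟨hvA, hv1, hvB⟩ := weight_bound hp₀ hp hc hm hpos hw hum hu0 huM
  set v : (Fin n → ℝ) → ℝ := fun x => w x ^ ((p₀ - 1) / (p - 1)) * u x ^ ((p - p₀) / (p - 1))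
    with hv
  have hvm : Measurable v := by fun_prop
  have hv0 : ∀ x, 0 < v x := fun x =>
    mul_pos (Real.rpow_pos_of_pos (hpos x) _) (Real.rpow_pos_of_pos (hu0 x) _)
  have hhw : ∀ᵐ x, h x * w x ≤ v x := by
    filter_upwards [hφu] with x hx
    have h1 : φ x ^ ((p - p₀) / (p - 1)) ≤ u x ^ ((p - p₀) / (p - 1)) :=
      Real.rpow_le_rpow (hφ0 x) hx (by positivity)
    have h2 : h x * w x = w x ^ ((p₀ - 1) / (p - 1)) * φ x ^ ((p - p₀) / (p - 1)) := by
      simp only [hφ]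
      rw [Real.mul_rpow (Real.rpow_nonneg (hh0 x) _) (hpos x).le, ← Real.rpow_mul (hh0 x)]
      have e1 : (p - 1) / (p - p₀) * ((p - p₀) / (p - 1)) = 1 := by field_simp
      rw [e1, Real.rpow_one, mul_left_comm, ← Real.rpow_add (hpos x)]
      have e2 : (p₀ - 1) / (p - 1) + (p - p₀) / (p - 1) = 1 := by field_simp; ring
      rw [e2, Real.rpow_one]
    rw [h2]
    exact mul_le_mul_of_nonneg_left h1 (Real.rpow_pos_of_pos (hpos x) _).le
  -- norm of f in L^{p₀}(v)
  have hfv : ∫⁻ x, ENNReal.ofReal |f x| ^ p₀ * ENNReal.ofReal (v x) ≤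
      eLpNormW p w f ^ p₀ * (ENNReal.ofReal ((1 + ε) / ε) ^ ((p - p₀) / (p - 1)) *
        I ^ ((p - p₀) / p)) := by
    have e : ∀ x, ENNReal.ofReal |f x| ^ p₀ * ENNReal.ofReal (v x) =
        (ENNReal.ofReal |f x| ^ p * ENNReal.ofReal (w x)) ^ (p₀ / p) *
        (ENNReal.ofReal |u x| ^ r * ENNReal.ofReal (s x)) ^ ((p - p₀) / p) := by
      intro x
      rw [abs_of_nonneg (hf0 x), abs_of_pos (hu0 x), ENNReal.mul_rpow_of_nonneg _ _ (by positivity),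
        ENNReal.mul_rpow_of_nonneg _ _ (by positivity), ← ENNReal.rpow_mul, ← ENNReal.rpow_mul]
      have e1 : p * (p₀ / p) = p₀ := by field_simp
      have e2 : r * ((p - p₀) / p) = (p - p₀) / (p - 1) := by rw [hr]; field_simp
      rw [e1, e2, mul_assoc]
      congr 1
      rw [ENNReal.ofReal_rpow_of_pos (hpos x), ENNReal.ofReal_rpow_of_pos (hu0 x),
        ENNReal.ofReal_rpow_of_pos (hs0 x),
        ← ENNReal.ofReal_mul (Real.rpow_pos_of_pos (hu0 x) _).le,
        ← ENNReal.ofReal_mul (Real.rpow_pos_of_pos (hpos x) _).le]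
      congr 1
      simp only [hv, hs]
      rw [← Real.rpow_mul (hpos x).le, mul_left_comm, ← Real.rpow_add (hpos x), mul_comm]
      congr 2
      rw [hr]; field_simp; ring
    rw [lintegral_congr e]
    refine (ENNReal.lintegral_mul_norm_pow_le (have := hf.1; by fun_prop) (by fun_prop)
      (by positivity) (by positivity) (by field_simp; ring)).trans ?_
    have a1 : eLpNormW p w f ^ p₀ =
        (∫⁻ x, ENNReal.ofReal |f x| ^ p * ENNReal.ofReal (w x)) ^ (p₀ / p) := by
      rw [eLpNormW_eq hpp0, ← ENNReal.rpow_mul]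
      congr 1; field_simp
    rw [a1]
    gcongr
    have a2 := ENNReal.rpow_le_rpow hun (show 0 ≤ (p - p₀) / (p - 1) by positivity)
    rw [hφn, eLpNormW_eq hr0, ENNReal.mul_rpow_of_nonneg _ _ (by positivity), ← ENNReal.rpow_mul,
      ← ENNReal.rpow_mul] at a2
    have e3 : 1 / r * ((p - p₀) / (p - 1)) = (p - p₀) / p := by rw [hr]; field_simp
    rwa [e3] at a2
  have hfvL : MemLpW p₀ v f := by
    refine ⟨hf.1, ?_⟩
    rw [eLpNormW_eq hp00]
    refine ENNReal.rpow_ne_top_of_nonneg (by positivity) (ne_top_of_le_ne_top ?_ hfv)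
    refine ENNReal.mul_ne_top (ENNReal.rpow_ne_top_of_nonneg hp00.le hf.2) (ENNReal.mul_ne_top ?_ ?_)
    · exact ENNReal.rpow_ne_top_of_nonneg (by positivity) ofReal_ne_top
    · exact ENNReal.rpow_ne_top_of_nonneg (by positivity) hIt
  have hT1 := hyp v hvA (hvB.trans hflat) f hfvL
  have hT2 := ENNReal.rpow_le_rpow hT1 hp00.le
  rw [ENNReal.mul_rpow_of_nonneg _ _ hp00.le, eLpNormW_eq hp00, eLpNormW_eq hp00,
    ← ENNReal.rpow_mul, ← ENNReal.rpow_mul, one_div_mul_cancel hp00.ne', ENNReal.rpow_one,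
    ENNReal.rpow_one] at hT2
  calc ∫⁻ x, ENNReal.ofReal (T f x) ^ p₀ * (ENNReal.ofReal (h x) * ENNReal.ofReal (w x))
      ≤ ∫⁻ x, ENNReal.ofReal |T f x| ^ p₀ * ENNReal.ofReal (v x) := by
        refine lintegral_mono_ae ?_
        filter_upwards [hhw] with x hx
        rw [abs_of_nonneg (hTpos f x), ← ENNReal.ofReal_mul (hh0 x)]
        gcongr
    _ ≤ _ := hT2
    _ ≤ _ := by
        gcongr
        exact hFmono _ _ hv1 hvB

lemma main_regular {n : ℕ} {p p₀ ε δ₀ N : ℝ} (hp₀ : 1 < p₀) (hp : p₀ < p) (hε : 0 < ε)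
    (F : ℝ → ℝ) 
    (hFmono : ∀ x y : ℝ, 1 ≤ x → x ≤ y → F x ≤ F y)
    (T : ((Fin n → ℝ) → ℝ) → (Fin n → ℝ) → ℝ)
    (hT : ∀ f, Measurable f → Measurable (T f))
    (hTpos : ∀ f x, 0 ≤ T f x)
    (hyp : ∀ v : (Fin n → ℝ) → ℝ, MemAp p₀ v → apChar p₀ v ≤ 1 + δ₀ →
      ∀ f, MemLpW p₀ v f →
        eLpNormW p₀ v (T f) ≤ ENNReal.ofReal (F (apChar p₀ v)) * eLpNormW p₀ v f)
    {w : (Fin n → ℝ) → ℝ} (hm : Measurable w) (hpos : ∀ x, 0 < w x) (hw : MemAp p w)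
    (hN : 1 ≤ N)
    (hb : StrongBound (p / (p - 1)) (fun x => w x ^ (1 - p / (p - 1))) maximal N)
    (hfin : ∀ f, MemLpW (p / (p - 1)) (fun x => w x ^ (1 - p / (p - 1))) f →
      ∀ᵐ x, maximalE f x < ⊤)
    (hflat : ((1 + ε) * N) ^ ((p - p₀) / (p - 1)) * apChar p w ^ ((p₀ - 1) / (p - 1)) ≤ 1 + δ₀)
    {f : (Fin n → ℝ) → ℝ} (hf : MemLpW p w f) (hf0 : ∀ x, 0 ≤ f x) :
    eLpNormW p w (T f)
        ≤ ENNReal.ofReal (((1 + ε) / ε) ^ ((p - p₀) / (p₀ * (p - 1))) *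
            F (((1 + ε) * N) ^ ((p - p₀) / (p - 1)) * apChar p w ^ ((p₀ - 1) / (p - 1)))) *
          eLpNormW p w f := by
  have hp1 : 0 < p - 1 := by linarith
  have hpp0 : 0 < p := by linarith
  have hp00 : 0 < p₀ := by linarith
  have hpp : 0 < p - p₀ := by linarith
  set FB := F (((1 + ε) * N) ^ ((p - p₀) / (p - 1)) * apChar p w ^ ((p₀ - 1) / (p - 1))) with hFB
  set A := (1 + ε) / ε with hA
  have hA0 : 0 < A := by positivity
  have hTm := hT f hf.1
  set g : ℕ → (Fin n → ℝ) → ℝ :=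
    fun k => (Metric.closedBall (0 : Fin n → ℝ) (k + 1)).indicator (fun x => min (T f x) k) with hg
  have hgm : ∀ k, Measurable (g k) := fun k =>
    (hTm.min measurable_const).indicator Metric.isClosed_closedBall.measurableSet
  have hg0 : ∀ k x, 0 ≤ g k x := fun k x =>
    Set.indicator_nonneg (fun x _ => le_min (hTpos f x) (by positivity)) x
  have hgT : ∀ k x, g k x ≤ T f x := fun k x =>
    Set.indicator_le' (fun x _ => min_le_left _ _) (fun x _ => hTpos f x) x
  set J : ℕ → ℝ≥0∞ := fun k => ∫⁻ x, ENNReal.ofReal (g k x) ^ p * ENNReal.ofReal (w x) with hJ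
  have hJt : ∀ k, J k ≠ ⊤ := by
    intro k
    have hQ : IsCube (Metric.closedBall (0 : Fin n → ℝ) (k + 1)) :=
      isCube_closedBall 0 _ (by positivity)
    have h1 : J k ≤ ∫⁻ x in Metric.closedBall (0 : Fin n → ℝ) (k + 1),
        ENNReal.ofReal k ^ p * ENNReal.ofReal (w x) := by
      rw [← lintegral_indicator hQ.measurableSet]
      refine lintegral_mono fun x => ?_
      by_cases hx : x ∈ Metric.closedBall (0 : Fin n → ℝ) (k + 1)
      · simp only [hg, Set.indicator_of_mem hx]
        gcongr
        exact min_le_right _ _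
      · simp only [hg, Set.indicator_of_notMem hx]
        simp [hpp0]
    rw [lintegral_const_mul _ (by fun_prop)] at h1
    exact ne_top_of_le_ne_top (ENNReal.mul_ne_top
      (ENNReal.rpow_ne_top_of_nonneg hpp0.le ofReal_ne_top) (lintegral_cube_ne_top hw.1.2 hQ)) h1
  set K := ENNReal.ofReal FB ^ p₀ * (eLpNormW p w f ^ p₀ *
    ENNReal.ofReal A ^ ((p - p₀) / (p - 1))) with hK
  have hJK : ∀ k, J k ^ (p₀ / p) ≤ K := by
    intro k
    by_cases hJ0 : J k = 0
    · rw [hJ0, ENNReal.zero_rpow_of_pos (by positivity)]; exact zero_le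
    have e : ∀ x, ENNReal.ofReal (g k x ^ (p - p₀)) ^ (p / (p - p₀)) = ENNReal.ofReal (g k x) ^ p := by
      intro x
      rw [← ENNReal.ofReal_rpow_of_nonneg (hg0 k x) hpp.le, ← ENNReal.rpow_mul]
      congr 1; field_simp
    have hk := key_dual hp₀ hp hε F hFmono T hTpos hyp hm hpos hw hN hb hfin hflat hf hf0
      (h := fun x => g k x ^ (p - p₀)) (by have := hgm k; fun_prop)
      (fun x => Real.rpow_nonneg (hg0 k x) _) (by simp_rw [e]; exact hJ0) (by simp_rw [e]; exact hJt k)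
    simp_rw [e] at hk
    have h1 : J k ≤ ∫⁻ x, ENNReal.ofReal (T f x) ^ p₀ *
        (ENNReal.ofReal (g k x ^ (p - p₀)) * ENNReal.ofReal (w x)) := by
      refine lintegral_mono fun x => ?_
      have e2 : ENNReal.ofReal (g k x) ^ p =
          ENNReal.ofReal (g k x) ^ p₀ * ENNReal.ofReal (g k x ^ (p - p₀)) := by
        rw [← ENNReal.ofReal_rpow_of_nonneg (hg0 k x) hpp.le,
          ← ENNReal.rpow_add_of_nonneg _ _ hp00.le hpp.le]
        congr 1; ring
      simp only []
      rw [e2, mul_assoc]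
      gcongr
      exact hgT k x
    have h2 : J k ≤ K * J k ^ ((p - p₀) / p) := by
      refine (h1.trans hk).trans (le_of_eq ?_)
      rw [hK]; ring
    have h3 : J k = J k ^ (p₀ / p) * J k ^ ((p - p₀) / p) := by
      rw [← ENNReal.rpow_add _ _ hJ0 (hJt k)]
      have : p₀ / p + (p - p₀) / p = 1 := by field_simp; ring
      rw [this, ENNReal.rpow_one]
    have h4 : J k ^ (p₀ / p) * J k ^ ((p - p₀) / p) ≤ K * J k ^ ((p - p₀) / p) := h3 ▸ h2
    exact (ENNReal.mul_le_mul_iff_left (ENNReal.rpow_pos (pos_iff_ne_zero.2 hJ0) (hJt k)).ne'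
      (ENNReal.rpow_ne_top_of_nonneg (by positivity) (hJt k))).1 h4
  have hlim : Tendsto J atTop (nhds (∫⁻ x, ENNReal.ofReal |T f x| ^ p * ENNReal.ofReal (w x))) := by
    refine lintegral_tendsto_of_tendsto_of_monotone (fun k => ?_) ?_ ?_
    · have := hgm k
      fun_prop
    · refine Eventually.of_forall fun x => ?_
      intro a b hab
      have hab' : (a : ℝ) ≤ b := by exact_mod_cast hab
      have : g a x ≤ g b x := by
        by_cases hx : x ∈ Metric.closedBall (0 : Fin n → ℝ) (a + 1)
        · have hx2 : x ∈ Metric.closedBall (0 : Fin n → ℝ) (b + 1) :=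
            Metric.closedBall_subset_closedBall (by linarith) hx
          simp only [hg, Set.indicator_of_mem hx, Set.indicator_of_mem hx2]
          exact min_le_min le_rfl hab'
        · simp only [hg, Set.indicator_of_notMem hx]
          exact hg0 b x
      simp only []
      gcongr
    · refine Eventually.of_forall fun x => ?_
      refine tendsto_const_nhds.congr' ?_
      obtain ⟨m, hm1⟩ := exists_nat_ge (max (T f x) ‖x‖)
      filter_upwards [eventually_ge_atTop m] with k hk
      have hk' : (m : ℝ) ≤ k := by exact_mod_cast hk
      have hx : x ∈ Metric.closedBall (0 : Fin n → ℝ) (k + 1) := by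
        rw [mem_closedBall_zero_iff]
        linarith [le_max_right (T f x) ‖x‖]
      simp only [hg, Set.indicator_of_mem hx]
      rw [min_eq_left (by linarith [le_max_left (T f x) ‖x‖]), abs_of_nonneg (hTpos f x)]
  have hfinal : (∫⁻ x, ENNReal.ofReal |T f x| ^ p * ENNReal.ofReal (w x)) ^ (p₀ / p) ≤ K :=
    le_of_tendsto ((ENNReal.continuous_rpow_const.tendsto _).comp hlim) (Eventually.of_forall hJK)
  have h5 := ENNReal.rpow_le_rpow hfinal (show 0 ≤ 1 / p₀ by positivity)
  rw [← ENNReal.rpow_mul] at h5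
  have e1 : p₀ / p * (1 / p₀) = 1 / p := by field_simp
  rw [e1, ← eLpNormW_eq hpp0, hK, ENNReal.mul_rpow_of_nonneg _ _ (by positivity),
    ENNReal.mul_rpow_of_nonneg _ _ (by positivity), ← ENNReal.rpow_mul, ← ENNReal.rpow_mul,
    ← ENNReal.rpow_mul, mul_one_div_cancel hp00.ne', ENNReal.rpow_one, ENNReal.rpow_one] at h5
  refine h5.trans (le_of_eq ?_)
  have e2 : (p - p₀) / (p - 1) * (1 / p₀) = (p - p₀) / (p₀ * (p - 1)) := by field_simp
  rw [e2, ENNReal.ofReal_mul (by positivity), ENNReal.ofReal_rpow_of_pos hA0]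
  ring

lemma avg_congr {n : ℕ} {a b : (Fin n → ℝ) → ℝ} (h : a =ᵐ[volume] b) (Q : Set (Fin n → ℝ)) :
    avg Q a = avg Q b := by
  unfold avg
  congr 1
  refine lintegral_congr_ae ?_
  filter_upwards [ae_restrict_of_ae (s := Q) h] with x hx
  rw [hx]

lemma apCharE_congr {n : ℕ} {a b : (Fin n → ℝ) → ℝ} (h : a =ᵐ[volume] b) (p : ℝ) :
    apCharE p a = apCharE p b := by
  unfold apCharE
  have h2 : (fun x => a x ^ (-(1 / (p - 1)))) =ᵐ[volume] (fun x => b x ^ (-(1 / (p - 1)))) := by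
    filter_upwards [h] with x hx
    rw [hx]
  simp_rw [avg_congr h, avg_congr h2]

lemma eLpNormW_congr {n : ℕ} {a b : (Fin n → ℝ) → ℝ} (h : a =ᵐ[volume] b) (p : ℝ)
    (f : (Fin n → ℝ) → ℝ) : eLpNormW p a f = eLpNormW p b f := by
  unfold eLpNormW
  congr 1
  refine lintegral_congr_ae ?_
  filter_upwards [h] with x hx
  rw [hx]

lemma opNorm_congr {n : ℕ} {a b : (Fin n → ℝ) → ℝ} (h : a =ᵐ[volume] b) (p : ℝ)
    (T : ((Fin n → ℝ) → ℝ) → (Fin n → ℝ) → ℝ) : opNorm p a T = opNorm p b T := by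
  unfold opNorm StrongBound MemLpW
  simp_rw [eLpNormW_congr h]


/-- **Quantitative flat extrapolation, upward case** (`p₀ < p`). With `p' = p/(p-1)`, if
`‖Tf‖_{L^{p₀}(v)} ≤ F([v]_{A_{p₀}}) ‖f‖_{L^{p₀}(v)}` for every `v ∈ A_{p₀}` with
`[v]_{A_{p₀}} ≤ 1 + δ₀`, `T` takes nonnegative values, and `w ∈ A_p` satisfies
`(1+ε)^{(p-p₀)/(p-1)} ‖M‖_{L^{p'}(w^{1-p'})}^{(p-p₀)/(p-1)} [w]_{A_p}^{(p₀-1)/(p-1)} ≤ 1 + δ₀`,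
then for every nonnegative `f ∈ L^p(w)`,
`‖Tf‖_{L^p(w)} ≤ ((1+ε)/ε)^{(p-p₀)/(p₀(p-1))} F(…) ‖f‖_{L^p(w)}` with the same argument of
`F` as in the flatness assumption. -/
theorem flat_extrapolation_upward
    (n : ℕ) (p p₀ ε δ₀ : ℝ) (hp₀ : 1 < p₀) (hp₀p : p₀ < p)
    (hε : 0 < ε) (hε1 : ε < 1) (hδ₀ : 0 < δ₀)
    (F : ℝ → ℝ) (hFpos : ∀ x : ℝ, 1 ≤ x → 0 < F x)
    (hFmono : ∀ x y : ℝ, 1 ≤ x → x ≤ y → F x ≤ F y)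
    (T : ((Fin n → ℝ) → ℝ) → (Fin n → ℝ) → ℝ)
    (hT : ∀ f, Measurable f → Measurable (T f))
    (hTpos : ∀ f x, 0 ≤ T f x)
    (hyp : ∀ v : (Fin n → ℝ) → ℝ, MemAp p₀ v → apChar p₀ v ≤ 1 + δ₀ →
      ∀ f, MemLpW p₀ v f →
        eLpNormW p₀ v (T f) ≤ ENNReal.ofReal (F (apChar p₀ v)) * eLpNormW p₀ v f)
    (w : (Fin n → ℝ) → ℝ) (hw : MemAp p w)
    (hflat : (1 + ε) ^ ((p - p₀) / (p - 1)) *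
        opNorm (p / (p - 1)) (fun x => w x ^ (1 - p / (p - 1))) maximal
          ^ ((p - p₀) / (p - 1)) *
        apChar p w ^ ((p₀ - 1) / (p - 1)) ≤ 1 + δ₀) :
    ∀ f, MemLpW p w f → (∀ x, 0 ≤ f x) →
      eLpNormW p w (T f)
        ≤ ENNReal.ofReal (((1 + ε) / ε) ^ ((p - p₀) / (p₀ * (p - 1))) *
            F ((1 + ε) ^ ((p - p₀) / (p - 1)) *
              opNorm (p / (p - 1)) (fun x => w x ^ (1 - p / (p - 1))) maximal
                ^ ((p - p₀) / (p - 1)) *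
              apChar p w ^ ((p₀ - 1) / (p - 1)))) *
          eLpNormW p w f := by
  intro f hf hf0
  have hp1 : 0 < p - 1 := by linarith
  have hpgt : 1 < p := by linarith
  -- a regular representative of the weight
  have hwm : AEMeasurable w volume := hw.1.2.aestronglyMeasurable.aemeasurable
  obtain ⟨w₁, hm₁, hpos₁, hww⟩ : ∃ w₁ : (Fin n → ℝ) → ℝ, Measurable w₁ ∧ (∀ x, 0 < w₁ x) ∧
      w =ᵐ[volume] w₁ := by
    refine ⟨fun x => if 0 < hwm.mk w x then hwm.mk w x else 1, ?_, ?_, ?_⟩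
    · exact Measurable.ite (measurableSet_lt measurable_const hwm.measurable_mk)
        hwm.measurable_mk measurable_const
    · intro x
      by_cases hx : 0 < hwm.mk w x
      · simp [hx]
      · simp [hx]
    · filter_upwards [hwm.ae_eq_mk, hw.1.1] with x hx hx0
      rw [← hx, if_pos hx0]
  have hss : (fun x => w x ^ (1 - p / (p - 1))) =ᵐ[volume]
      (fun x => w₁ x ^ (1 - p / (p - 1))) := by
    filter_upwards [hww] with x hx
    rw [hx]
  have hchar : apCharE p w = apCharE p w₁ := apCharE_congr hww p
  have hchar' : apChar p w = apChar p w₁ := by unfold apChar; rw [hchar]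
  have hw₁ : MemAp p w₁ := by
    refine ⟨⟨Eventually.of_forall hpos₁, ?_⟩, hchar ▸ hw.2⟩
    intro x
    obtain ⟨s, hs, hsi⟩ := hw.1.2 x
    exact ⟨s, hs, Integrable.congr hsi (ae_restrict_of_ae hww)⟩
  have hf₁ : MemLpW p w₁ f := ⟨hf.1, eLpNormW_congr hww p f ▸ hf.2⟩
  rw [hchar', opNorm_congr hss] at hflat ⊢
  rw [eLpNormW_congr hww, eLpNormW_congr hww]
  obtain ⟨hex, hfin⟩ := maximal_bdd hpgt hm₁ hpos₁ hw₁
  have hee : 1 - p / (p - 1) = -(1 / (p - 1)) := by field_simp; ring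
  obtain ⟨hb, hN⟩ := opNorm_spec (r := p / (p - 1)) (s := fun x => w₁ x ^ (1 - p / (p - 1)))
    (by positivity) (by fun_prop) (fun x => Real.rpow_pos_of_pos (hpos₁ x) _)
    (fun Q hQ => by rw [hee]; exact dual_finite hpgt hm₁ hpos₁ hw₁ hQ) hex
  have hN0 : 0 ≤ opNorm (p / (p - 1)) (fun x => w₁ x ^ (1 - p / (p - 1))) maximal := by linarith
  rw [← Real.mul_rpow (by positivity) hN0] at hflat ⊢
  exact main_regular hp₀ hp₀p hε F hFmono T hT hTpos hyp hm₁ hpos₁ hw₁ hN hb hfin hflat hf₁ hf0
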